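/- arXiv:2510.14734 — 4 statements merged into one kernel-verified Lean document; each statement's English description precedes it below -/
import Mathlib

section
/- Let d = 4. There exists C < ∞ such that for all sufficiently large T ∈ ℕ, setting t' = ⌊T·log^{-10}T⌋ and r = ⌊(t')^{1/2}·log^{-1/4}T⌋, the simple random walk from the origin satisfies E^0[ |B(X[0,t'], r)| ] ≤ C·(t')²·log^{-1/2}T, where B(A,s) = {y ∈ ℤ^4 : ∃ x ∈ A with |x−y|_∞ ≤ s} is the ℓ^∞ s-neighborhood of A. -/
open MeasureTheory ProbabilityTheory Filter Topology
open scoped ENNReal NNReal Classical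

noncomputable section

namespace FRIPaper

/-- The lattice `ℤ^d`. -/
abbrev Zd (d : ℕ) := Fin d → ℤ

/-- `x` and `y` are nearest neighbours in `ℤ^d` (`ℓ¹`-distance one). -/
def IsNN {d : ℕ} (x y : Zd d) : Prop := (∑ i, (x i - y i).natAbs) = 1

/-- Event that a one-sided path never visits `A` at a positive time
(i.e. `H̃_A = ∞` for the path started anywhere). -/
def NoReturn {d : ℕ} (A : Set (Zd d)) : Set (ℕ → Zd d) := {ω | ∀ t : ℕ, 0 < t → ω t ∉ A}

/-- Event that a one-sided path does not visit `A` at a positive time `t ≤ s`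
(i.e. `H̃_A > s`). -/
def NoReturnUpTo {d : ℕ} (A : Set (Zd d)) (s : ℝ) : Set (ℕ → Zd d) :=
  {ω | ∀ t : ℕ, 0 < t → (t : ℝ) ≤ s → ω t ∉ A}

/-- Specification of the law `P^x` of the discrete-time simple random walk on `ℤ^d`
started at `x`, as a measure on the path space `ℕ → ℤ^d`: it is the unique probability
measure giving each nearest-neighbour cylinder of length `T` based at `x`
probability `(2d)^{-T}`. -/
def IsSRW (d : ℕ) (x : Zd d) (P : Measure (ℕ → Zd d)) : Prop :=
  IsProbabilityMeasure P ∧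
    ∀ (T : ℕ) (w : ℕ → Zd d),
      P {ω | ∀ t ≤ T, ω t = w t} =
        if w 0 = x ∧ ∀ t < T, IsNN (w t) (w (t + 1)) then
          (((2 * d : ℕ) : ℝ≥0∞))⁻¹ ^ T else 0

/-- A family `P x`, `x ∈ ℤ^d`, of simple random walk laws. -/
def IsSRWFamily (d : ℕ) (P : Zd d → Measure (ℕ → Zd d)) : Prop := ∀ x, IsSRW d x (P x)

/-- Equilibrium measure `e_A(x) = P^x[H̃_A = ∞] 1_{x ∈ A}`. -/
def equil {d : ℕ} (P : Zd d → Measure (ℕ → Zd d)) (A : Set (Zd d)) (x : Zd d) : ℝ :=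
  if x ∈ A then (P x (NoReturn A)).toReal else 0

/-- Capacity `cap(A) = Σ_{x∈A} e_A(x)`. -/
def capacity {d : ℕ} (P : Zd d → Measure (ℕ → Zd d)) (A : Finset (Zd d)) : ℝ :=
  ∑ x ∈ A, equil P (↑A) x

/-- Truncated capacity `cap(A,T) = Σ_{x∈A} P^x[H̃_A > T·(log T)^{-10}]`. -/
def capTrunc {d : ℕ} (P : Zd d → Measure (ℕ → Zd d)) (A : Finset (Zd d)) (T : ℝ) : ℝ :=
  ∑ x ∈ A, (P x (NoReturnUpTo (↑A) (T / (Real.log T) ^ (10 : ℕ)))).toReal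

/-- `X[a,b]`, the set of points visited by the path between times `a` and `b`. -/
def walkRange {d : ℕ} (ω : ℕ → Zd d) (a b : ℕ) : Finset (Zd d) := (Finset.Icc a b).image ω

/-- `E^0[cap(X[0,T])]`. -/
def capExpect {d : ℕ} (P : Zd d → Measure (ℕ → Zd d)) (T : ℕ) : ℝ :=
  ∫ ω, capacity P (walkRange ω 0 T) ∂ (P 0)

/-- `1 + log x · 1_{d = 4}`. -/
def logFour (d : ℕ) (x : ℝ) : ℝ := 1 + if d = 4 then Real.log x else 0

/-- `ε` is the constant `ε_d = lim_{T→∞} E^0[cap(X[0,T])]·T^{-1}·(1 + log T·1_{d=4})`,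
which lies in `(0,∞)`. -/
def IsCapLimit (d : ℕ) (P : Zd d → Measure (ℕ → Zd d)) (ε : ℝ) : Prop :=
  0 < ε ∧ Tendsto (fun T : ℕ => capExpect P T * logFour d T / (T : ℝ)) atTop (𝓝 ε)

/-! ### Distributions on `ℕ` -/

/-- `ρ` is a probability distribution on `ℕ`. -/
def IsDist (ρ : ℕ → ℝ) : Prop := (∀ k, 0 ≤ ρ k) ∧ HasSum ρ 1

/-- `k`-th moment `μ_k(ρ)`. -/
def mu (k : ℕ) (ρ : ℕ → ℝ) : ℝ := ∑' l : ℕ, (l : ℝ) ^ k * ρ l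

/-- Tail `μ_k^{(m)}(ρ) = Σ_{l ≥ m} l^k ρ(l)`. -/
def muTail (k m : ℕ) (ρ : ℕ → ℝ) : ℝ := ∑' l : ℕ, if m ≤ l then (l : ℝ) ^ k * ρ l else 0

/-- An appropriate family of distributions on `ℕ`. -/
def Appropriate (ρ : ℕ → ℕ → ℝ) : Prop :=
  (∀ n, IsDist (ρ n)) ∧
  (∀ n, Summable fun l : ℕ => (l : ℝ) ^ 2 * ρ n l) ∧
  Tendsto (fun n => mu 1 (ρ n)) atTop atTop ∧
  ∀ ε : ℝ, 0 < ε → ∃ C : ℝ,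
    ∀ n, (∑' L : ℕ, if C * mu 1 (ρ n) ≤ (L : ℝ) then (L : ℝ) ^ 2 * ρ n L / mu 2 (ρ n) else 0) ≤ ε

/-- Geometric distribution `Geo(λ)(k) = λ (1-λ)^k`. -/
def geo (lam : ℝ) (k : ℕ) : ℝ := lam * (1 - lam) ^ k

/-! ### Trajectories and finitary random interlacements -/

/-- A finite trajectory in `ℤ^d`, recorded as the list of its positions. -/
abbrev Traj (d : ℕ) := List (Zd d)

/-- A point configuration: the multiplicity of each trajectory. -/
abbrev Config (d : ℕ) := Traj d → ℕ

/-- A valid trajectory: a nonempty nearest-neighbour path. -/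
def ValidTraj {d : ℕ} (η : Traj d) : Prop := η ≠ [] ∧ η.Chain' IsNN

/-- The time length `T(η)` of a trajectory. -/
def len {d : ℕ} (η : Traj d) : ℕ := η.length - 1

/-- The range of a trajectory, as a set. -/
def rangeSet {d : ℕ} (η : Traj d) : Set (Zd d) := {y | y ∈ η}

/-- The trajectory `η` visits the set `A`. -/
def hits {d : ℕ} (η : Traj d) (A : Set (Zd d)) : Prop := ∃ y ∈ η, y ∈ A

/-- Poisson probability mass `e^{-r} r^n / n!`. -/
def poissonProb (r : ℝ) (n : ℕ) : ℝ≥0∞ :=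
  ENNReal.ofReal (Real.exp (-r) * r ^ n / n.factorial)

/-- The intensity `u·π({η})` that FRI with parameters `(u,ρ)` puts on a single
trajectory `η`: trajectories of length `l` from each starting point carry mass
`u·ρ(l)/(μ₁(ρ)+1)·(2d)^{-l}` each. -/
def friIntensity (d : ℕ) (u : ℝ) (ρ : ℕ → ℝ) (η : Traj d) : ℝ :=
  if ValidTraj η then u * ρ (len η) / (mu 1 ρ + 1) * (1 / (2 * (d : ℝ))) ^ (len η) else 0

/-- `P` is the law of a Poisson point process on the countable set of trajectories
with intensity function `ι`: the multiplicities of distinct trajectories are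
independent Poisson random variables. -/
def IsPoissonPP (d : ℕ) (ι : Traj d → ℝ) (P : Measure (Config d)) : Prop :=
  IsProbabilityMeasure P ∧
    ∀ (F : Finset (Traj d)) (k : Traj d → ℕ),
      P {ω | ∀ η ∈ F, ω η = k η} = ∏ η ∈ F, poissonProb (ι η) (k η)

/-- `P` is the law of the finitary random interlacements point process `𝒳^{u,ρ}`. -/
def IsFRI (d : ℕ) (u : ℝ) (ρ : ℕ → ℝ) (P : Measure (Config d)) : Prop :=
  IsPoissonPP d (friIntensity d u ρ) P

/-- `J` is the law of an i.i.d. sequence of copies of `𝒳^{u,ρ}`. -/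
def IsFRIseq (d : ℕ) (u : ℝ) (ρ : ℕ → ℝ) (J : Measure (ℕ → Config d)) : Prop :=
  IsProbabilityMeasure J ∧
    ∀ (F : Finset (ℕ × Traj d)) (k : ℕ × Traj d → ℕ),
      J {j | ∀ p ∈ F, j p.1 p.2 = k p} = ∏ p ∈ F, poissonProb (friIntensity d u ρ p.2) (k p)

/-! ### Percolation -/

/-- The edge `{x,y}` is traversed by some trajectory of the configuration `ω`. -/
def EdgeOpen {d : ℕ} (ω : Config d) (x y : Zd d) : Prop :=
  ∃ η : Traj d, 0 < ω η ∧ ∃ i : ℕ,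
    (η[i]? = some x ∧ η[i + 1]? = some y) ∨ (η[i]? = some y ∧ η[i + 1]? = some x)

/-- The cluster of `x` in the subgraph `ℐ` induced by the configuration `ω`. -/
def Cluster {d : ℕ} (ω : Config d) (x : Zd d) : Set (Zd d) :=
  {y | Relation.ReflTransGen (EdgeOpen ω) x y}

/-- The origin lies in an infinite cluster. -/
def PercEvent (d : ℕ) : Set (Config d) := {ω | (Cluster ω 0).Infinite}

/-- The critical intensity `u_*(ρ)`, given the family `u ↦ 𝒳^{u,ρ}`. -/
def uStar (d : ℕ) (X : ℝ → Measure (Config d)) : ℝ :=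
  sInf {u : ℝ | 0 ≤ u ∧ 0 < X u (PercEvent d)}

/-- The order `u_n = μ₁(ρ)·(1 + log μ₁(ρ)·1_{d=4}) / (ε_d·μ₂(ρ))` of the
critical intensity. -/
def uN (d : ℕ) (εd : ℝ) (ρ : ℕ → ℝ) : ℝ :=
  mu 1 ρ * logFour d (mu 1 ρ) / (εd * mu 2 ρ)

/-! ### `ρ`-capacity, Green function, `κ` and `φ` -/

/-- `e_A^{(ρ)}(x) = Σ_m (μ₀^{(m)}(ρ)/(μ₁(ρ)+1))·P^x[H̃_A > m]`. -/
def equilRho {d : ℕ} (P : Zd d → Measure (ℕ → Zd d)) (ρ : ℕ → ℝ) (A : Set (Zd d))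
    (x : Zd d) : ℝ :=
  ∑' m : ℕ, (muTail 0 m ρ / (mu 1 ρ + 1)) * (P x (NoReturnUpTo A (m : ℝ))).toReal

/-- `cap^{(ρ)}(A) = Σ_{x∈A} e_A^{(ρ)}(x)`. -/
def capRho {d : ℕ} (P : Zd d → Measure (ℕ → Zd d)) (ρ : ℕ → ℝ) (A : Finset (Zd d)) : ℝ :=
  ∑ x ∈ A, equilRho P ρ (↑A) x

/-- Green's function `g(x,y) = Σ_t P^x[X_t = y]`. -/
def green {d : ℕ} (P : Zd d → Measure (ℕ → Zd d)) (x y : Zd d) : ℝ :=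
  ∑' t : ℕ, (P x {ω | ω t = y}).toReal

/-- `φ^{(ρ)}(A,B) = Σ_{x∈A} Σ_{y∈B} e_A^{(ρ)}(x) e_B^{(ρ)}(y) g(x,y)`. -/
def phiRho {d : ℕ} (P : Zd d → Measure (ℕ → Zd d)) (ρ : ℕ → ℝ) (A B : Finset (Zd d)) : ℝ :=
  ∑ x ∈ A, ∑ y ∈ B, equilRho P ρ (↑A) x * equilRho P ρ (↑B) y * green P x y

/-- `κ^{(ρ)}(A) = Σ_{x∈A} Σ_m (μ₁^{(m)}(ρ)/μ₂(ρ))·P^x[H̃_A > m]` (real-valued,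
for finite `A`). -/
def kappa {d : ℕ} (P : Zd d → Measure (ℕ → Zd d)) (ρ : ℕ → ℝ) (A : Finset (Zd d)) : ℝ :=
  ∑ x ∈ A, ∑' m : ℕ, (muTail 1 m ρ / mu 2 ρ) * (P x (NoReturnUpTo (↑A) (m : ℝ))).toReal

/-- `κ^{(ρ)}(A)` as an extended-real valued quantity, for arbitrary `A`. -/
def kappaE {d : ℕ} (P : Zd d → Measure (ℕ → Zd d)) (ρ : ℕ → ℝ) (A : Set (Zd d)) : ℝ≥0∞ :=
  ∑' x : Zd d,
    A.indicator (fun x => ∑' m : ℕ,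
      ENNReal.ofReal (muTail 1 m ρ / mu 2 ρ) * P x (NoReturnUpTo A (m : ℝ))) x

/-! ### Exploration processes -/

/-- First components: the `k`-th layer `L_k` of vertices; second components:
`∪_{i<k} L_i`.  Layer `L_{k+1}` is spanned by the trajectories of `ω` meeting `L_k`
but not `∪_{i<k} L_i`. -/
def exploreSets {d : ℕ} (ω : Config d) : ℕ → Set (Zd d) × Set (Zd d)
  | 0 => ({0}, ∅)
  | k + 1 =>
    ({y | ∃ η : Traj d, 0 < ω η ∧ hits η (exploreSets ω k).1 ∧
        ¬ hits η (exploreSets ω k).2 ∧ y ∈ η},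
      (exploreSets ω k).1 ∪ (exploreSets ω k).2)

/-- The `i`-th layer `𝓛_i` of trajectories of the exploration of the cluster of the
origin, as a sub-configuration of `ω`. -/
def exploreLayer {d : ℕ} (ω : Config d) : ℕ → Config d
  | 0 => fun _ => 0
  | k + 1 => fun η =>
      if hits η (exploreSets ω k).1 ∧ ¬ hits η (exploreSets ω k).2 then ω η else 0

/-- The vertex sets `L'_k` of the dominating exploration driven by the i.i.d.
sequence `j`. -/
def exploreSets' {d : ℕ} (j : ℕ → Config d) : ℕ → Set (Zd d)
  | 0 => {0}
  | k + 1 => {y | ∃ η : Traj d, 0 < j (k + 1) η ∧ hits η (exploreSets' j k) ∧ y ∈ η}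

/-- The trajectory layers `𝓛'_i` of the dominating exploration. -/
def exploreLayer' {d : ℕ} (j : ℕ → Config d) : ℕ → Config d
  | 0 => fun _ => 0
  | k + 1 => fun η => if hits η (exploreSets' j k) then j (k + 1) η else 0

/-- `W_k = 𝔼[κ^{(ρ)}(L'_k)]`. -/
def Wexp {d : ℕ} (P : Zd d → Measure (ℕ → Zd d)) (ρ : ℕ → ℝ)
    (J : Measure (ℕ → Config d)) (k : ℕ) : ℝ≥0∞ :=
  ∫⁻ j, kappaE P ρ (exploreSets' j k) ∂ J

/-- `V_k = 𝔼[|L'_k|]`, multiplied by `(log μ₁(ρ))⁻¹` when `d = 4`. -/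
def Vexp (d : ℕ) (ρ : ℕ → ℝ) (J : Measure (ℕ → Config d)) (k : ℕ) : ℝ≥0∞ :=
  (if d = 4 then ENNReal.ofReal (1 / Real.log (mu 1 ρ)) else 1) *
    ∫⁻ j, ENat.toENNReal (exploreSets' j k).encard ∂ J

/-! ### Two-sided finite random walk trajectories -/

/-- `μ(x,m,l)({η})`: the two-sided path `(X_{-m},…,X_l)` of a doubly infinite walk
with `X_0 = x` equals the list `η` (of length `m+l+1`, with `η[m] = x`)
with probability `(2d)^{-(m+l)}` for every admissible nearest-neighbour list. -/
def twoSidedProb (d : ℕ) (x : Zd d) (m l : ℕ) (η : Traj d) : ℝ :=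
  if η.length = m + l + 1 ∧ η.Chain' IsNN ∧ η[m]? = some x then
    (1 / (2 * (d : ℝ))) ^ (m + l) else 0

/-- The `ℓ^∞`-diameter of the range of `η` is at most `R`. -/
def DiamLE {d : ℕ} (η : Traj d) (R : ℝ) : Prop :=
  ∀ a ∈ η, ∀ b ∈ η, ∀ i, |((a i - b i : ℤ) : ℝ)| ≤ R

/-- `P^x[X[-m,-1] ∩ A = ∅]`: the probability that an `m`-step walk from `x`
avoids `A` at all positive times, written combinatorially. -/
def backAvoidProb (d : ℕ) (A : Set (Zd d)) (x : Zd d) (m : ℕ) : ℝ :=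
  ∑' w : Traj d,
    if w.length = m + 1 ∧ w.Chain' IsNN ∧ w[0]? = some x ∧
        (∀ i : ℕ, 0 < i → ∀ y, w[i]? = some y → y ∉ A) then
      (1 / (2 * (d : ℝ))) ^ m else 0

/-- `μ(x,m,l;A)({η}) = P^x[X[-m,l] = η | X[-m,-1] ∩ A = ∅]`. -/
def condTwoSidedProb (d : ℕ) (A : Set (Zd d)) (x : Zd d) (m l : ℕ) (η : Traj d) : ℝ :=
  (if ∀ i < m, ∀ y, η[i]? = some y → y ∉ A then twoSidedProb d x m l η else 0) /
    backAvoidProb d A x m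

/-- `π_A({η}) = Σ_{x∈A} Σ_{m,l} (ρ(m+l)/(μ₁(ρ)+1))·P^x[H̃_A > m]·μ(x,m,l;A)({η})`. -/
def piA (d : ℕ) (P : Zd d → Measure (ℕ → Zd d)) (ρ : ℕ → ℝ) (A : Finset (Zd d))
    (η : Traj d) : ℝ :=
  ∑ x ∈ A, ∑' m : ℕ, ∑' l : ℕ,
    ρ (m + l) / (mu 1 ρ + 1) * (P x (NoReturnUpTo (↑A) (m : ℝ))).toReal *
      condTwoSidedProb d (↑A) x m l η

/-- The sub-configuration of trajectories meeting `A`, i.e. `𝒳[A]`. -/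
def restrictConfig {d : ℕ} (A : Finset (Zd d)) (ω : Config d) : Config d :=
  fun η => if hits η (↑A) then ω η else 0

/-! ### Products and geometric laws -/

/-- The geometric measure `Geo(1/(T+1))` on `ℕ`. -/
def geoMeasure (T : ℕ) : Measure ℕ :=
  Measure.sum fun k : ℕ => (ENNReal.ofReal (geo (1 / ((T : ℝ) + 1)) k)) • Measure.dirac k

/-- `Q` is the product (independent coupling) of `μ` and `ν`. -/
def IsProdOf {α β : Type*} [MeasurableSpace α] [MeasurableSpace β]
    (Q : Measure (α × β)) (μ : Measure α) (ν : Measure β) : Prop :=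
  IsProbabilityMeasure Q ∧
    ∀ (A : Set α) (B : Set β), MeasurableSet A → MeasurableSet B → Q (A ×ˢ B) = μ A * ν B

/-! ### Coarse graining quantities -/

/-- The constant `c = 0.01`. -/
def cConst : ℝ := 0.01

/-- `R_n = ⌊√(μ₁(ρ_n))⌋`. -/
def Rn (ρ : ℕ → ℕ → ℝ) (n : ℕ) : ℕ := ⌊Real.sqrt (mu 1 (ρ n))⌋₊

/-- The mesoscopic scale `L_n`. -/
def Ln (d : ℕ) (ρ : ℕ → ℕ → ℝ) (n : ℕ) : ℝ :=
  if d = 4 then (Rn ρ n : ℝ) * (Real.log (Rn ρ n)) ^ (-cConst)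
  else (Rn ρ n : ℝ) ^ ((2 + cConst) / ((d : ℝ) - 2))

/-- The slowly growing factor `I_n`. -/
def In (d : ℕ) (ρ : ℕ → ℕ → ℝ) (n : ℕ) : ℝ :=
  if d = 4 then (Real.log (Rn ρ n)) ^ cConst else (Rn ρ n : ℝ) ^ cConst

/-- The scale `T'_n`. -/
def Tn' (d : ℕ) (ρ : ℕ → ℕ → ℝ) (n : ℕ) : ℕ :=
  if d = 4 then ⌊(Rn ρ n : ℝ) ^ (2 : ℕ) / Real.log (mu 1 (ρ n))⌋₊
  else ⌊(Rn ρ n : ℝ) ^ ((2 : ℝ) - cConst / 4)⌋₊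

/-- The scale `l_n`. -/
def lnPar (d : ℕ) (ρ : ℕ → ℕ → ℝ) (n : ℕ) : ℕ :=
  if d = 4 then ⌊(Rn ρ n : ℝ) * (Real.log (Rn ρ n)) ^ (-(2 * cConst))⌋₊
  else ⌊(Rn ρ n : ℝ) ^ ((1 : ℝ) - cConst / 4)⌋₊

/-- The scale `t_n`. -/
def tnPar (d : ℕ) (ρ : ℕ → ℕ → ℝ) (n : ℕ) : ℕ :=
  if d = 4 then ⌊(Rn ρ n : ℝ) ^ (2 : ℕ) / (Real.log (Rn ρ n)) ^ (10 : ℕ)⌋₊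
  else ⌊(Rn ρ n : ℝ) ^ ((2 : ℝ) - cConst)⌋₊

/-- `y` is within `ℓ^∞`-distance `r` of `z`. -/
def InBall {d : ℕ} (y z : Zd d) (r : ℝ) : Prop := ∀ i, |((y i - z i : ℤ) : ℝ)| ≤ r

/-- The `ℓ^∞` `r`-neighbourhood `B(A,r)`. -/
def nbhd {d : ℕ} (A : Set (Zd d)) (r : ℝ) : Set (Zd d) := {y | ∃ z ∈ A, InBall y z r}

/-- The sub-path `η[a, b]` of a trajectory. -/
def segment {d : ℕ} (η : Traj d) (a b : ℕ) : Traj d := (η.drop a).take (b - a + 1)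

/-- `η` is a typical trajectory (the event `𝒯_n = ℰ₁ ∩ ℰ₂ ∩ ℰ₃ ∩ ℰ₄`). -/
def Typical (d : ℕ) (P : Zd d → Measure (ℕ → Zd d)) (εd : ℝ) (ρ : ℕ → ℕ → ℝ)
    (kk KK M θ1 : ℝ) (n : ℕ) (η : Traj d) : Prop :=
  ValidTraj η ∧
  -- ℰ₁
  (kk * (Rn ρ n : ℝ) ^ 2 ≤ (len η : ℝ) ∧ (len η : ℝ) ≤ KK * (Rn ρ n : ℝ) ^ 2 ∧
    ∀ y ∈ η, InBall y η.headI (M * (Rn ρ n : ℝ))) ∧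
  -- ℰ₂
  (if d = 4 then
    (1 - θ1 ^ 2) * (Real.pi ^ 2 / 8) * (len η : ℝ) / Real.log (mu 1 (ρ n)) <
        capacity P η.toFinset ∧
      capTrunc P η.toFinset ((Rn ρ n : ℝ) ^ 2) <
        (1 + θ1 ^ 2) * (Real.pi ^ 2 / 8) * (len η : ℝ) / Real.log (mu 1 (ρ n))
  else
    (1 - θ1 ^ 2) * εd * (len η : ℝ) < capacity P η.toFinset ∧
      capacity P η.toFinset < (1 + θ1 ^ 2) * εd * (len η : ℝ)) ∧
  -- ℰ₃
  ((Set.ncard (nbhd (rangeSet η) (Ln d ρ n)) : ℝ) <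
    (Rn ρ n : ℝ) ^ 2 * (Ln d ρ n) ^ (d - 2) * (In d ρ n) ^ ((1 : ℝ) / 3)) ∧
  -- ℰ₄
  (∀ j : ℕ, j * Tn' d ρ n ≤ len η →
    if d = 4 then
      capacity P (segment η (j * Tn' d ρ n) (min ((j + 1) * Tn' d ρ n) (len η))).toFinset ≤
          (1 + θ1 ^ 2) * (Real.pi ^ 2 / 8) * (Tn' d ρ n : ℝ) / Real.log (mu 1 (ρ n)) ∧
        ∀ a ∈ segment η (j * Tn' d ρ n) (min ((j + 1) * Tn' d ρ n) (len η)),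
          ∀ b ∈ segment η (j * Tn' d ρ n) (min ((j + 1) * Tn' d ρ n) (len η)),
            ∀ i, |((a i - b i : ℤ) : ℝ)| <
              (1 / 2) * Real.sqrt (len η : ℝ) * (Real.log (mu 1 (ρ n))) ^ (-cConst)
    else
      capacity P (segment η (j * Tn' d ρ n) (min ((j + 1) * Tn' d ρ n) (len η))).toFinset ≤
        (1 + θ1 ^ 2) * εd * (Tn' d ρ n : ℝ))

/-- `x` belongs to the `*`-proper part `η̂` of the trajectory `η`. -/
def ProperStar (d : ℕ) (P : Zd d → Measure (ℕ → Zd d)) (ρ : ℕ → ℕ → ℝ)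
    (θ1 θ2 : ℝ) (n : ℕ) (η : Traj d) (x : Zd d) : Prop :=
  x ∈ rangeSet η ∧
    (if d = 4 then
      θ2 / Real.log (mu 1 (ρ n)) ≤ equil P (rangeSet η) x ∧
        (P x (NoReturnUpTo (rangeSet η)
            ((Rn ρ n : ℝ) ^ 2 / (Real.log (Rn ρ n)) ^ (10 : ℕ)))).toReal ≤
          (1 + θ1) * equil P (rangeSet η) x
    else θ2 ≤ equil P (rangeSet η) x)

/-! ### Proof: auxiliary material -/

/-- The eight unit steps of `ℤ⁴`. -/
def stp (e : Fin 4 × Bool) : Zd 4 := fun i => if i = e.1 then (if e.2 then 1 else -1) else 0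

lemma stp_injective : Function.Injective stp := by
  rintro ⟨a, b⟩ ⟨c, d⟩ h
  have h1 := congrFun h a
  have h2 := congrFun h c
  simp only [stp] at h1 h2
  by_cases hac : a = c
  · subst hac
    cases b <;> cases d <;> simp_all
  · have : c ≠ a := fun h => hac h.symm
    cases b <;> simp_all

lemma isNN_stp (x : Zd 4) (e : Fin 4 × Bool) : IsNN x (x + stp e) := by
  unfold IsNN
  rw [Finset.sum_eq_single e.1]
  · cases h : e.2 <;> simp [stp, h]
  · intro b _ hb
    simp [stp, hb]
  · simp

/-- Extend a path after time `N` by one step, then stay there. -/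
def ext (N : ℕ) (w : ℕ → Zd 4) (e : Fin 4 × Bool) : ℕ → Zd 4 :=
  fun t => if t ≤ N then w t else w N + stp e

lemma ext_le {N t : ℕ} (w : ℕ → Zd 4) (e : Fin 4 × Bool) (h : t ≤ N) : ext N w e t = w t := by
  simp [ext, h]

lemma ext_gt {N t : ℕ} (w : ℕ → Zd 4) (e : Fin 4 × Bool) (h : N < t) :
    ext N w e t = w N + stp e := by
  simp [ext, h]

/-- The frozen nearest-neighbour paths of length `N`. -/
def pths : ℕ → Finset (ℕ → Zd 4)
  | 0 => {fun _ => 0}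
  | N + 1 => ((pths N) ×ˢ (Finset.univ : Finset (Fin 4 × Bool))).image (fun p => ext N p.1 p.2)

lemma pths_spec (N : ℕ) : ∀ w ∈ pths N, w 0 = 0 ∧ (∀ t < N, IsNN (w t) (w (t + 1))) ∧
    ∀ t, N ≤ t → w t = w N := by
  induction N with
  | zero => intro w hw; simp only [pths, Finset.mem_singleton] at hw; subst hw; simp
  | succ N ih =>
    intro w hw
    simp only [pths, Finset.mem_image, Finset.mem_product, Finset.mem_univ, and_true] at hw
    obtain ⟨⟨v, e⟩, hv, rfl⟩ := hw
    obtain ⟨h0, h1, h2⟩ := ih v hv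
    refine ⟨by rw [ext_le _ _ (Nat.zero_le _)]; exact h0, ?_, ?_⟩
    · intro t ht
      rcases Nat.lt_succ_iff_lt_or_eq.mp ht with h | rfl
      · rw [ext_le _ _ h.le, ext_le _ _ h]; exact h1 t h
      · rw [ext_le _ _ le_rfl, ext_gt _ _ (Nat.lt_succ_self _)]; exact isNN_stp _ _
    · intro t ht
      rw [ext_gt _ _ ht, ext_gt _ _ (Nat.lt_succ_self _)]

lemma sum_pths_succ (N : ℕ) (f : (ℕ → Zd 4) → ℝ) :
    ∑ w ∈ pths (N + 1), f w = ∑ w ∈ pths N, ∑ e, f (ext N w e) := by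
  rw [pths, Finset.sum_image, Finset.sum_product]
  rintro ⟨v, e⟩ hv ⟨v', e'⟩ hv' h
  simp only [Finset.coe_product, Set.mem_prod, Finset.mem_coe] at hv hv'
  simp only at h
  have hle : ∀ t ≤ N, v t = v' t := fun t ht => by
    have := congrFun h t; rwa [ext_le _ _ ht, ext_le _ _ ht] at this
  have hvv : v = v' := by
    funext t
    rcases le_total t N with ht | ht
    · exact hle t ht
    · rw [(pths_spec N v hv.1).2.2 t ht, (pths_spec N v' hv'.1).2.2 t ht, hle N le_rfl]
  subst hvv
  have := congrFun h (N + 1)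
  rw [ext_gt _ _ (Nat.lt_succ_self _), ext_gt _ _ (Nat.lt_succ_self _)] at this
  rw [stp_injective (add_left_cancel this)]

/-- Expectation over the first `N` steps. -/
def Ex (N : ℕ) (f : (ℕ → Zd 4) → ℝ) : ℝ := (8⁻¹ : ℝ) ^ N * ∑ w ∈ pths N, f w

lemma Ex_succ (N : ℕ) (f : (ℕ → Zd 4) → ℝ) :
    Ex (N + 1) f = Ex N (fun w => 8⁻¹ * ∑ e, f (ext N w e)) := by
  unfold Ex
  rw [sum_pths_succ, ← Finset.mul_sum, pow_succ]; ring

lemma Ex_mono (N : ℕ) {f g : (ℕ → Zd 4) → ℝ} (h : ∀ w, f w ≤ g w) : Ex N f ≤ Ex N g := by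
  unfold Ex
  gcongr with w _
  exact h w

lemma Ex_add (N : ℕ) (f g : (ℕ → Zd 4) → ℝ) : Ex N (fun w => f w + g w) = Ex N f + Ex N g := by
  unfold Ex; rw [Finset.sum_add_distrib]; ring

lemma Ex_smul (N : ℕ) (c : ℝ) (f : (ℕ → Zd 4) → ℝ) : Ex N (fun w => c * f w) = c * Ex N f := by
  unfold Ex; rw [← Finset.mul_sum]; ring

lemma Ex_const (N : ℕ) (c : ℝ) : Ex N (fun _ => c) = c := by
  induction N with
  | zero => simp [Ex, pths]
  | succ N ih => rw [Ex_succ]; simp [Fintype.card_prod]; convert ih using 2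

/-- `g` depends only on coordinates up to time `N`. -/
def Dep (N : ℕ) (g : (ℕ → Zd 4) → ℝ) : Prop := ∀ ω ω', (∀ t ≤ N, ω t = ω' t) → g ω = g ω'

lemma measurableSet_cyl (N : ℕ) (w : ℕ → Zd 4) :
    MeasurableSet {ω : ℕ → Zd 4 | ∀ t ≤ N, ω t = w t} := by
  have : {ω : ℕ → Zd 4 | ∀ t ≤ N, ω t = w t} = ⋂ t, ⋂ (_ : t ≤ N), (fun ω => ω t) ⁻¹' {w t} := by
    ext ω; simp
  rw [this]
  exact MeasurableSet.iInter fun t => MeasurableSet.iInter fun _ =>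
    (measurable_pi_apply t) (measurableSet_singleton _)

lemma integral_dep {P : Measure (ℕ → Zd 4)} (hP : IsSRW 4 0 P) (N : ℕ)
    (g : (ℕ → Zd 4) → ℝ) (hg : Dep N g) : Integrable g P ∧ ∫ ω, g ω ∂P = Ex N g := by
  obtain ⟨hp, hc⟩ := hP
  let cyl : (ℕ → Zd 4) → Set (ℕ → Zd 4) := fun w => {ω | ∀ t ≤ N, ω t = w t}
  have hmeas : ∀ w, MeasurableSet (cyl w) := measurableSet_cyl N
  have hPc : ∀ w ∈ pths N, P.real (cyl w) = (8⁻¹ : ℝ) ^ N := by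
    intro w hw
    obtain ⟨h0, h1, _⟩ := pths_spec N w hw
    have := hc N w
    rw [if_pos ⟨h0, h1⟩] at this
    rw [measureReal_def, this]
    norm_num
  have hdisj : (pths N : Set (ℕ → Zd 4)).PairwiseDisjoint cyl := by
    intro v hv v' hv' hne
    rw [Function.onFun, Set.disjoint_left]
    intro ω h h'
    apply hne
    have hle : ∀ t ≤ N, v t = v' t := fun t ht => (h t ht).symm.trans (h' t ht)
    funext t
    rcases le_total t N with ht | ht
    · exact hle t ht
    · rw [(pths_spec N v hv).2.2 t ht, (pths_spec N v' hv').2.2 t ht, hle N le_rfl]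
  have hU : P.real (⋃ w ∈ pths N, cyl w) = 1 := by
    rw [measureReal_biUnion_finset hdisj (fun w _ => hmeas w), Finset.sum_congr rfl hPc]
    have := Ex_const N 1
    simp only [Ex, Finset.sum_const, nsmul_eq_mul] at this ⊢
    linarith
  have hae : ∀ᵐ ω ∂P, ω ∈ ⋃ w ∈ pths N, cyl w := by
    have hm : MeasurableSet (⋃ w ∈ pths N, cyl w) :=
      Finset.measurableSet_biUnion _ fun w _ => hmeas w
    refine (mem_ae_iff_prob_eq_one hm).2 ?_
    rw [measureReal_def] at hU
    rw [← ENNReal.ofReal_toReal (measure_ne_top P _), hU, ENNReal.ofReal_one]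
  have hgae : g =ᵐ[P] fun ω => ∑ w ∈ pths N, (cyl w).indicator (fun _ => g w) ω := by
    filter_upwards [hae] with ω hω
    simp only [Set.mem_iUnion] at hω
    obtain ⟨w, hw, hωw⟩ := hω
    rw [Finset.sum_eq_single w]
    · rw [Set.indicator_of_mem hωw]; exact hg _ _ hωw
    · intro v hv hne
      rw [Set.indicator_of_notMem]
      exact fun h => Set.disjoint_left.mp (hdisj hv hw hne) h hωw
    · exact fun h => absurd hw h
  have hint : ∀ w ∈ pths N, Integrable ((cyl w).indicator (fun _ => g w)) P := fun w _ =>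
    (integrable_const _).indicator (hmeas w)
  refine ⟨(integrable_finsetSum _ hint).congr hgae.symm, ?_⟩
  rw [integral_congr_ae hgae, integral_finsetSum _ hint, Ex, Finset.mul_sum]
  refine Finset.sum_congr rfl fun w hw => ?_
  rw [integral_indicator_const _ (hmeas w), hPc w hw, smul_eq_mul]

lemma sum_stp (i : Fin 4) (F : ℤ → ℝ) : ∑ e, F (stp e i) = F 1 + F (-1) + 6 * F 0 := by
  rw [Fintype.sum_prod_type]
  fin_cases i <;> simp [Fin.sum_univ_four, stp] <;> ring

/-- Displacement of coordinate `i` between times `a` and `a + n`. -/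
def dS (a : ℕ) (i : Fin 4) (n : ℕ) (ω : ℕ → Zd 4) : ℤ := ω (a + n) i - ω a i

/-- Running maximum of the absolute displacement. -/
def mx (a : ℕ) (i : Fin 4) : ℕ → (ℕ → Zd 4) → ℕ
  | 0, _ => 0
  | n + 1, ω => max (mx a i n ω) (dS a i (n + 1) ω).natAbs

lemma le_mx (a : ℕ) (i : Fin 4) (ω : ℕ → Zd 4) (n : ℕ) :
    ∀ u ≤ n, (dS a i u ω).natAbs ≤ mx a i n ω := by
  induction n with
  | zero => intro u hu; obtain rfl := Nat.le_zero.mp hu; simp [dS]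
  | succ n ih =>
    intro u hu
    rcases Nat.le_succ_iff.mp hu with h | rfl
    · exact (ih u h).trans (le_max_left _ _)
    · exact le_max_right _ _

lemma dS_congr (a : ℕ) (i : Fin 4) (n : ℕ) (ω ω' : ℕ → Zd 4) (h : ∀ t ≤ a + n, ω t = ω' t) :
    dS a i n ω = dS a i n ω' := by
  unfold dS; rw [h _ le_rfl, h a (by omega)]

lemma mx_congr (a : ℕ) (i : Fin 4) (n : ℕ) (ω ω' : ℕ → Zd 4) (h : ∀ t ≤ a + n, ω t = ω' t) :
    mx a i n ω = mx a i n ω' := by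
  induction n with
  | zero => rfl
  | succ n ih =>
    rw [mx, mx, ih (fun t ht => h t (by omega)), dS_congr a i (n + 1) ω ω' h]

lemma dS_ext (a : ℕ) (i : Fin 4) (n : ℕ) (ω : ℕ → Zd 4) (e : Fin 4 × Bool) :
    dS a i (n + 1) (ext (a + n) ω e) = dS a i n ω + stp e i := by
  unfold dS
  rw [ext_gt _ _ (by omega : a + n < a + (n + 1)), ext_le _ _ (by omega : a ≤ a + n)]
  simp only [Pi.add_apply]; ring

lemma mx_ext (a : ℕ) (i : Fin 4) (n : ℕ) (ω : ℕ → Zd 4) (e : Fin 4 × Bool) :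
    mx a i (n + 1) (ext (a + n) ω e) = max (mx a i n ω) (dS a i n ω + stp e i).natAbs := by
  rw [mx, dS_ext, mx_congr a i n _ ω (fun t ht => ext_le _ _ ht)]

lemma Ex_sq (a : ℕ) (i : Fin 4) (n : ℕ) :
    Ex (a + n) (fun ω => (dS a i n ω : ℝ) ^ 2) = n / 4 := by
  induction n with
  | zero => simp [dS, Ex]
  | succ n ih =>
    rw [← add_assoc, Ex_succ]
    have : (fun w => (8⁻¹ : ℝ) * ∑ e, (dS a i (n + 1) (ext (a + n) w e) : ℝ) ^ 2) =
        fun w => (dS a i n w : ℝ) ^ 2 + 1 / 4 := by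
      funext w
      simp only [dS_ext]
      rw [sum_stp i (fun z => ((dS a i n w + z : ℤ) : ℝ) ^ 2)]
      push_cast; ring
    rw [this, Ex_add, ih, Ex_const]; push_cast; ring

lemma Ex_four (a : ℕ) (i : Fin 4) (n : ℕ) :
    Ex (a + n) (fun ω => (dS a i n ω : ℝ) ^ 4) ≤ (n : ℝ) ^ 2 := by
  induction n with
  | zero => simp [dS, Ex]
  | succ n ih =>
    rw [← add_assoc, Ex_succ]
    have : (fun w => (8⁻¹ : ℝ) * ∑ e, (dS a i (n + 1) (ext (a + n) w e) : ℝ) ^ 4) =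
        fun w => (dS a i n w : ℝ) ^ 4 + ((3 / 2) * (dS a i n w : ℝ) ^ 2 + 1 / 4) := by
      funext w
      simp only [dS_ext]
      rw [sum_stp i (fun z => ((dS a i n w + z : ℤ) : ℝ) ^ 4)]
      push_cast; ring
    rw [this, Ex_add, Ex_add, Ex_smul, Ex_sq, Ex_const]; push_cast
    have : (0 : ℝ) ≤ n := Nat.cast_nonneg n
    nlinarith

lemma potential_step (m : ℕ) (z : ℤ) (y : ℝ) :
    ((m : ℝ) ^ 2 * y - (m : ℝ) ^ 4 / 2) + (m : ℝ) ^ 2 * ((z : ℝ) ^ 2 - y) ≤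
      ((max m z.natAbs : ℕ) : ℝ) ^ 2 * (z : ℝ) ^ 2 - ((max m z.natAbs : ℕ) : ℝ) ^ 4 / 2 := by
  rcases le_total z.natAbs m with h | h
  · rw [max_eq_left h]; apply le_of_eq; ring
  · rw [max_eq_right h]
    have : ((z.natAbs : ℕ) : ℝ) ^ 2 = (z : ℝ) ^ 2 := by
      rw [Nat.cast_natAbs, Int.cast_abs, sq_abs]
    have h4 : ((z.natAbs : ℕ) : ℝ) ^ 4 = (z : ℝ) ^ 2 * (z : ℝ) ^ 2 := by
      rw [← this]; ring
    rw [h4, this]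
    nlinarith [sq_nonneg ((m : ℝ) ^ 2 - (z : ℝ) ^ 2)]

lemma Ex_potential (a : ℕ) (i : Fin 4) (n : ℕ) :
    0 ≤ Ex (a + n) (fun ω => (mx a i n ω : ℝ) ^ 2 * (dS a i n ω : ℝ) ^ 2 -
      (mx a i n ω : ℝ) ^ 4 / 2) := by
  induction n with
  | zero => simp [dS, mx, Ex]
  | succ n ih =>
    refine ih.trans ?_
    rw [← add_assoc, Ex_succ]
    apply Ex_mono
    intro w
    simp only [dS_ext, mx_ext]
    have h := Finset.sum_le_sum (s := (Finset.univ : Finset (Fin 4 × Bool))) fun e _ =>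
      potential_step (mx a i n w) (dS a i n w + stp e i) ((dS a i n w : ℝ) ^ 2)
    rw [sum_stp i (fun z => ((mx a i n w : ℝ) ^ 2 * (dS a i n w : ℝ) ^ 2 -
      (mx a i n w : ℝ) ^ 4 / 2) + (mx a i n w : ℝ) ^ 2 * (((dS a i n w + z : ℤ) : ℝ) ^ 2 -
        (dS a i n w : ℝ) ^ 2))] at h
    push_cast at h ⊢
    nlinarith [sq_nonneg (mx a i n w : ℝ)]

lemma Ex_mx (a : ℕ) (i : Fin 4) (n : ℕ) :
    Ex (a + n) (fun ω => (mx a i n ω : ℝ) ^ 4) ≤ 4 * (n : ℝ) ^ 2 := by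
  have h1 := Ex_potential a i n
  have h2 := Ex_four a i n
  have h3 : Ex (a + n) (fun ω => (mx a i n ω : ℝ) ^ 2 * (dS a i n ω : ℝ) ^ 2 -
      (mx a i n ω : ℝ) ^ 4 / 2) ≤ Ex (a + n) (fun ω => (-(1 / 4)) * (mx a i n ω : ℝ) ^ 4 +
        (dS a i n ω : ℝ) ^ 4) := by
    apply Ex_mono
    intro w
    nlinarith [sq_nonneg ((mx a i n w : ℝ) ^ 2 / 2 - (dS a i n w : ℝ) ^ 2)]
  rw [Ex_add, Ex_smul] at h3
  linarith

lemma mx_integral {P : Measure (ℕ → Zd 4)} (hP : IsSRW 4 0 P) (a : ℕ) (i : Fin 4) (n : ℕ) :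
    Integrable (fun ω => (mx a i n ω : ℝ) ^ 4) P ∧
      ∫ ω, (mx a i n ω : ℝ) ^ 4 ∂P ≤ 4 * (n : ℝ) ^ 2 := by
  obtain ⟨h1, h2⟩ := integral_dep hP (a + n) (fun ω => (mx a i n ω : ℝ) ^ 4)
    (fun ω ω' h => by simp only [mx_congr a i n ω ω' h])
  exact ⟨h1, h2.trans_le (Ex_mx a i n)⟩

/-- Volume bound of one block. -/
def vb (r b a : ℕ) (ω : ℕ → Zd 4) : ℝ :=
  8 * (81 * (r : ℝ) ^ 4 + 16 * (64 * ∑ i, (mx a i b ω : ℝ) ^ 4))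

lemma vb_integral {P : Measure (ℕ → Zd 4)} (hP : IsSRW 4 0 P) (r a : ℕ) :
    Integrable (vb r (r ^ 2) a) P ∧ ∫ ω, vb r (r ^ 2) a ω ∂P ≤ 200000 * (r : ℝ) ^ 4 := by
  have := hP.1
  have hs : Integrable (fun ω => ∑ i, (mx a i (r ^ 2) ω : ℝ) ^ 4) P :=
    integrable_finsetSum _ fun i _ => (mx_integral hP a i (r ^ 2)).1
  have hs2 : ∫ ω, ∑ i, (mx a i (r ^ 2) ω : ℝ) ^ 4 ∂P ≤ 16 * (r : ℝ) ^ 4 := by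
    rw [integral_finsetSum _ fun i _ => (mx_integral hP a i (r ^ 2)).1]
    refine (Finset.sum_le_sum fun i _ => (mx_integral hP a i (r ^ 2)).2).trans ?_
    simp; apply le_of_eq; ring
  have e : vb r (r ^ 2) a = fun ω => 648 * (r : ℝ) ^ 4 + 8192 * ∑ i, (mx a i (r ^ 2) ω : ℝ) ^ 4 := by
    funext ω; unfold vb; ring
  rw [e]
  refine ⟨(integrable_const _).add (hs.const_mul _), ?_⟩
  rw [integral_add (integrable_const _) (hs.const_mul _), integral_const,
    probReal_univ, one_smul,
    integral_const_mul (8192 : ℝ) (fun ω => ∑ i, (mx a i (r ^ 2) ω : ℝ) ^ 4)]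
  have : (0 : ℝ) ≤ (r : ℝ) ^ 4 := by positivity
  linarith

/-- The box covering one block of the sausage. -/
def bx (r b a : ℕ) (ω : ℕ → Zd 4) : Finset (Zd 4) :=
  Fintype.piFinset fun i => Finset.Icc (ω a i - ((r + ∑ j, mx a j b ω : ℕ) : ℤ))
    (ω a i + ((r + ∑ j, mx a j b ω : ℕ) : ℤ))

lemma bx_card (r b a : ℕ) (hr : 1 ≤ r) (ω : ℕ → Zd 4) : ((bx r b a ω).card : ℝ) ≤ vb r b a ω := by
  have hcard : (bx r b a ω).card = (2 * (r + ∑ j, mx a j b ω) + 1) ^ 4 := by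
    unfold bx
    rw [Fintype.card_piFinset]
    simp only [Int.card_Icc]
    rw [Finset.prod_congr rfl (g := fun _ => 2 * (r + ∑ j, mx a j b ω) + 1)]
    · simp
    · intro i _; omega
  rw [hcard]
  have hp := pow_sum_div_card_le_sum_pow (s := (Finset.univ : Finset (Fin 4)))
    (f := fun j => (mx a j b ω : ℝ)) (fun _ _ => Nat.cast_nonneg _) 3
  simp only [Finset.card_univ, Fintype.card_fin] at hp
  push_cast
  unfold vb
  set s : ℝ := ∑ j, (mx a j b ω : ℝ) with hs
  have hs0 : 0 ≤ s := Finset.sum_nonneg fun _ _ => Nat.cast_nonneg _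
  have hr' : (1 : ℝ) ≤ r := by exact_mod_cast hr
  have h1 : (2 * ((r : ℝ) + s) + 1) ^ 4 ≤ (3 * (r : ℝ) + 2 * s) ^ 4 := by
    exact pow_le_pow_left₀ (by positivity) (by linarith) 4
  have h2 : (3 * (r : ℝ) + 2 * s) ^ 4 ≤ 8 * ((3 * (r : ℝ)) ^ 4 + (2 * s) ^ 4) := by
    have := add_pow_le (by positivity : 0 ≤ 3 * (r : ℝ)) (by positivity : 0 ≤ 2 * s) 4
    norm_num at this ⊢; exact this
  norm_num at hp
  nlinarith

lemma ncard_le (r b n : ℕ) (hr : 1 ≤ r) (hb : 1 ≤ b) (ω : ℕ → Zd 4) :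
    (Set.ncard {y : Zd 4 | ∃ s ≤ n, InBall y (ω s) (r : ℝ)} : ℝ) ≤
      ∑ j ∈ Finset.range (n / b + 1), vb r b (j * b) ω := by
  have hsub : {y : Zd 4 | ∃ s ≤ n, InBall y (ω s) (r : ℝ)} ⊆
      ↑((Finset.range (n / b + 1)).biUnion fun j => bx r b (j * b) ω) := by
    rintro y ⟨s, hs, hy⟩
    simp only [Finset.coe_biUnion, Set.mem_iUnion, Finset.mem_coe, Finset.mem_range]
    refine ⟨s / b, Nat.lt_succ_of_le (Nat.div_le_div_right hs), ?_⟩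
    unfold bx
    rw [Fintype.mem_piFinset]
    intro i
    rw [Finset.mem_Icc]
    have h1 : |y i - ω s i| ≤ (r : ℤ) := by
      have := hy i
      exact_mod_cast this
    have h2 := le_mx (s / b * b) i ω b (s % b) (Nat.mod_lt _ hb).le
    have h3 : mx (s / b * b) i b ω ≤ ∑ j, mx (s / b * b) j b ω :=
      Finset.single_le_sum (f := fun j => mx (s / b * b) j b ω) (fun _ _ => Nat.zero_le _)
        (Finset.mem_univ i)
    have h4 : s / b * b + s % b = s := Nat.div_add_mod' s b
    unfold dS at h2
    rw [h4] at h2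
    rw [abs_le] at h1
    omega
  have h := Set.ncard_le_ncard hsub (Finset.finite_toSet _)
  rw [Set.ncard_coe_finset] at h
  calc (Set.ncard {y : Zd 4 | ∃ s ≤ n, InBall y (ω s) (r : ℝ)} : ℝ)
      ≤ ((∑ j ∈ Finset.range (n / b + 1), (bx r b (j * b) ω).card : ℕ) : ℝ) := by
        exact_mod_cast h.trans Finset.card_biUnion_le
    _ ≤ _ := by
        push_cast
        exact Finset.sum_le_sum fun j _ => bx_card r b _ hr ω

lemma sausage_bound {P : Measure (ℕ → Zd 4)} (hP : IsSRW 4 0 P) (r n : ℕ) (hr : 1 ≤ r) :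
    ∫ ω, (Set.ncard {y : Zd 4 | ∃ s ≤ n, InBall y (ω s) (r : ℝ)} : ℝ) ∂P ≤
      ((n : ℝ) / (r : ℝ) ^ 2 + 1) * (200000 * (r : ℝ) ^ 4) := by
  have hb : 1 ≤ r ^ 2 := Nat.one_le_pow _ _ hr
  calc _ ≤ ∫ ω, ∑ j ∈ Finset.range (n / r ^ 2 + 1), vb r (r ^ 2) (j * r ^ 2) ω ∂P := by
        apply integral_mono_of_nonneg
        · exact Eventually.of_forall fun ω => Nat.cast_nonneg _
        · exact integrable_finsetSum _ fun j _ => (vb_integral hP r _).1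
        · exact Eventually.of_forall fun ω => ncard_le r (r ^ 2) n hr hb ω
    _ = ∑ j ∈ Finset.range (n / r ^ 2 + 1), ∫ ω, vb r (r ^ 2) (j * r ^ 2) ω ∂P :=
        integral_finsetSum _ fun j _ => (vb_integral hP r _).1
    _ ≤ ∑ j ∈ Finset.range (n / r ^ 2 + 1), 200000 * (r : ℝ) ^ 4 :=
        Finset.sum_le_sum fun j _ => (vb_integral hP r _).2
    _ ≤ _ := by
        rw [Finset.sum_const, Finset.card_range, nsmul_eq_mul]
        gcongr
        have : ((n / r ^ 2 : ℕ) : ℝ) ≤ (n : ℝ) / ((r ^ 2 : ℕ) : ℝ) := Nat.cast_div_le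
        push_cast at this ⊢
        linarith

lemma final_arith (n l : ℝ) (r : ℕ) (hl : 1 ≤ l) (hn : l ≤ n)
    (hr : r = ⌊Real.sqrt n * l ^ (-(1 : ℝ) / 4)⌋₊) :
    1 ≤ r ∧ (n / (r : ℝ) ^ 2 + 1) * (200000 * (r : ℝ) ^ 4) ≤ 1000000 * n ^ 2 / Real.sqrt l := by
  have hl0 : 0 < l := by linarith
  have hn0 : 0 < n := by linarith
  set x := Real.sqrt n * l ^ (-(1 : ℝ) / 4) with hx
  set q := Real.sqrt l with hq
  have hq0 : 0 < q := Real.sqrt_pos.2 hl0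
  have hqq : q ^ 2 = l := Real.sq_sqrt hl0.le
  have hq1 : 1 ≤ q := by rw [hq, Real.one_le_sqrt]; exact hl
  have hx0 : 0 ≤ x := by positivity
  have hx2 : x ^ 2 = n / q := by
    rw [hx, mul_pow, Real.sq_sqrt hn0.le, ← Real.rpow_natCast (l ^ (-(1 : ℝ) / 4)),
      ← Real.rpow_mul hl0.le, hq, Real.sqrt_eq_rpow, div_eq_mul_inv n, ← Real.rpow_neg hl0.le]
    norm_num
  have hx1 : 1 ≤ x := by
    have : 1 ≤ x ^ 2 := by
      rw [hx2, le_div_iff₀ hq0]; nlinarith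
    nlinarith
  have hr1 : 1 ≤ r := by rw [hr]; exact Nat.le_floor (by simpa using hx1)
  have hrx : (r : ℝ) ≤ x := by rw [hr]; exact Nat.floor_le hx0
  have hxr : x < r + 1 := by rw [hr]; exact Nat.lt_floor_add_one x
  have hr1' : (1 : ℝ) ≤ r := by exact_mod_cast hr1
  refine ⟨hr1, ?_⟩
  have e1 : (n / (r : ℝ) ^ 2 + 1) * (200000 * (r : ℝ) ^ 4) =
      200000 * (n + (r : ℝ) ^ 2) * (r : ℝ) ^ 2 := by field_simp
  have hr2 : (r : ℝ) ^ 2 ≤ n / q := by rw [← hx2]; gcongr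
  have hnq : n / q ≤ n := div_le_self hn0.le hq1
  rw [e1]
  calc 200000 * (n + (r : ℝ) ^ 2) * (r : ℝ) ^ 2 ≤ 200000 * (n + n) * (n / q) := by
        gcongr; linarith
    _ = 400000 * (n ^ 2 / q) := by ring
    _ ≤ 1000000 * (n ^ 2 / q) := by gcongr; norm_num
    _ = _ := by ring

/-- Volume estimate for a sausage around a walk in `ℤ⁴`: with
`t' = ⌊T (log T)^{-10}⌋` and `r = ⌊(t')^{1/2}(log T)^{-1/4}⌋`,
`E^0[|B(X[0,t'], r)|] ≤ C (t')² (log T)^{-1/2}` for all large `T`. -/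
theorem four_dim_sausage_volume
    (Pw : Zd 4 → Measure (ℕ → Zd 4)) (hPw : IsSRWFamily 4 Pw) :
    ∃ C : ℝ, 0 < C ∧ ∀ᶠ T : ℕ in atTop,
      (∫ ω, (Set.ncard {y : Zd 4 | ∃ s ≤ ⌊(T : ℝ) / (Real.log T) ^ (10 : ℕ)⌋₊,
          InBall y (ω s)
            ((⌊Real.sqrt ((⌊(T : ℝ) / (Real.log T) ^ (10 : ℕ)⌋₊ : ℕ) : ℝ) *
                (Real.log T) ^ (-(1 : ℝ) / 4)⌋₊ : ℝ))} : ℝ) ∂ (Pw 0)) ≤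
      C * ((⌊(T : ℝ) / (Real.log T) ^ (10 : ℕ)⌋₊ : ℕ) : ℝ) ^ 2 / Real.sqrt (Real.log T) := by
  refine ⟨1000000, by norm_num, ?_⟩
  have hlog : Tendsto (fun T : ℕ => Real.log T) atTop atTop :=
    Real.tendsto_log_atTop.comp tendsto_natCast_atTop_atTop
  have h21 : ∀ᶠ T : ℕ in atTop, Real.log T ^ 12 ≤ (T : ℝ) := by
    have := (Real.isLittleO_pow_log_id_atTop (n := 12)).bound (by norm_num : (0 : ℝ) < 1)
    filter_upwards [tendsto_natCast_atTop_atTop.eventually this] with T hT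
    simp only [id, one_mul, Real.norm_eq_abs, Nat.abs_cast] at hT
    exact (le_abs_self _).trans hT
  filter_upwards [hlog.eventually_ge_atTop 2, h21] with T hl hT
  set l := Real.log T with hl_def
  set n := ⌊(T : ℝ) / l ^ (10 : ℕ)⌋₊ with hn
  have hl0 : 0 < l := by linarith
  have hln : l ≤ (n : ℝ) := by
    have h1 : l ^ 2 ≤ (T : ℝ) / l ^ 10 := by
      rw [le_div_iff₀ (by positivity)]
      calc l ^ 2 * l ^ 10 = l ^ 12 := by ring
        _ ≤ _ := hT
    have h2 : (T : ℝ) / l ^ 10 < n + 1 := Nat.lt_floor_add_one _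
    nlinarith
  obtain ⟨hr, hb⟩ := final_arith n l _ (by linarith) hln rfl
  exact (sausage_bound (hPw 0) _ n hr).trans hb

end FRIPaper
end
end

section
/- Let d ≥ 3 and let ρ be a probability distribution on ℕ with 3 ≤ μ_1(ρ) < ∞. Then for every finite A ⊆ ℤ^d, cap^{(ρ)}(A) ≤ |A|·(⌊μ_1(ρ)·log^{-10}μ_1(ρ)⌋ + 1)/(μ_1(ρ)+1) + cap(A, μ_1(ρ)); in particular cap^{(ρ)}(A) ≤ |A|·(log^{-10}μ_1(ρ) + (μ_1(ρ)+1)^{-1}) + cap(A, μ_1(ρ)). -/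
open MeasureTheory ProbabilityTheory Filter Topology
open scoped ENNReal NNReal Classical

noncomputable section

namespace FRIPaper

theorem hasSum_muTail (ρ : ℕ → ℝ) (hρ : IsDist ρ) (hsum : Summable fun l : ℕ => (l : ℝ) * ρ l) :
    HasSum (fun m : ℕ => muTail 0 m ρ) (mu 1 ρ + 1) := by
  have hrow : ∀ l : ℕ, HasSum (fun m : ℕ => if m ≤ l then ρ l else 0) ((l : ℝ) * ρ l + ρ l) := by
    intro l
    have h := hasSum_sum_of_ne_finset_zero (L := SummationFilter.unconditional ℕ) (f := fun m : ℕ => if m ≤ l then ρ l else 0)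
      (s := Finset.range (l + 1)) (by
        intro m hm
        have : ¬ m ≤ l := by
          simp only [Finset.mem_range] at hm
          omega
        simp [this])
    have h2 : ∑ m ∈ Finset.range (l + 1), (if m ≤ l then ρ l else 0) = (l : ℝ) * ρ l + ρ l := by
      rw [Finset.sum_congr rfl (g := fun _ => ρ l)]
      · simp
        ring
      · intro m hm
        have : m ≤ l := by
          simp only [Finset.mem_range] at hm
          omega
        simp [this]
    rwa [h2] at h
  have htot : HasSum (fun l : ℕ => (l : ℝ) * ρ l + ρ l) (mu 1 ρ + 1) := by
    have h1 : HasSum (fun l : ℕ => (l : ℝ) * ρ l) (mu 1 ρ) := by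
      have := hsum.hasSum
      simpa [mu] using this
    exact h1.add hρ.2
  have hS : Summable (fun p : ℕ × ℕ => if p.2 ≤ p.1 then ρ p.1 else 0) := by
    rw [summable_prod_of_nonneg]
    · refine ⟨fun l => (hrow l).summable, ?_⟩
      have : (fun l : ℕ => ∑' m : ℕ, if m ≤ l then ρ l else 0) =
          fun l : ℕ => (l : ℝ) * ρ l + ρ l := funext fun l => (hrow l).tsum_eq
      exact this ▸ htot.summable
    · intro p
      show (0 : ℝ) ≤ if p.2 ≤ p.1 then ρ p.1 else 0
      split_ifs
      · exact hρ.1 _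
      · exact le_rfl
  have hT := hS.hasSum
  have e := (hT.prod_fiberwise hrow).unique htot
  rw [e] at hT
  have hT2 : HasSum (fun p : ℕ × ℕ => if p.1 ≤ p.2 then ρ p.2 else 0) (mu 1 ρ + 1) :=
    (Equiv.prodComm ℕ ℕ).hasSum_iff.mp hT
  refine hT2.prod_fiberwise fun m => ?_
  have h := (hT2.summable.prod_factor m).hasSum
  simpa [muTail] using h

theorem muTail_zero_bounds (ρ : ℕ → ℝ) (hρ : IsDist ρ) (m : ℕ) :
    0 ≤ muTail 0 m ρ ∧ muTail 0 m ρ ≤ 1 := by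
  have hn : ∀ l : ℕ, (0 : ℝ) ≤ if m ≤ l then (l : ℝ) ^ 0 * ρ l else 0 := by
    intro l
    split_ifs
    · simpa using hρ.1 l
    · exact le_rfl
  have hl : ∀ l : ℕ, (if m ≤ l then (l : ℝ) ^ 0 * ρ l else 0) ≤ ρ l := by
    intro l
    split_ifs
    · simp
    · exact hρ.1 l
  refine ⟨tsum_nonneg hn, ?_⟩
  rw [← hρ.2.tsum_eq]
  exact (Summable.of_nonneg_of_le hn hl hρ.2.summable).tsum_le_tsum hl hρ.2.summable

theorem equilRho_le {d : ℕ} (P : Zd d → Measure (ℕ → Zd d)) (hP : IsSRWFamily d P)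
    (ρ : ℕ → ℝ) (hρ : IsDist ρ) (hsum : Summable fun l : ℕ => (l : ℝ) * ρ l)
    (hmean : 3 ≤ mu 1 ρ) (A : Set (Zd d)) (x : Zd d) (s : ℝ) :
    equilRho P ρ A x ≤ ((⌊s⌋₊ : ℕ) + 1) / (mu 1 ρ + 1) + (P x (NoReturnUpTo A s)).toReal := by
  have : IsProbabilityMeasure (P x) := (hP x).1
  have hpos : 0 < mu 1 ρ + 1 := by linarith
  set p := (P x (NoReturnUpTo A s)).toReal with hp
  have hp0 : 0 ≤ p := ENNReal.toReal_nonneg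
  have h1 : HasSum (fun m : ℕ => muTail 0 m ρ / (mu 1 ρ + 1) * p) p := by
    have := ((hasSum_muTail ρ hρ hsum).div_const (mu 1 ρ + 1)).mul_right p
    rwa [div_self hpos.ne', one_mul] at this
  have h2 : HasSum (fun m : ℕ => if m ∈ Finset.range (⌊s⌋₊ + 1) then 1 / (mu 1 ρ + 1) else 0)
      (((⌊s⌋₊ : ℕ) + 1) / (mu 1 ρ + 1)) := by
    have h := hasSum_sum_of_ne_finset_zero (L := SummationFilter.unconditional ℕ)
      (f := fun m : ℕ => if m ∈ Finset.range (⌊s⌋₊ + 1) then 1 / (mu 1 ρ + 1) else 0)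
      (s := Finset.range (⌊s⌋₊ + 1)) (fun m hm => if_neg hm)
    rw [Finset.sum_congr rfl (fun m hm => if_pos hm)] at h
    simpa [div_eq_mul_inv] using h
  have hle : ∀ m : ℕ, muTail 0 m ρ / (mu 1 ρ + 1) * (P x (NoReturnUpTo A (m : ℝ))).toReal ≤
      (if m ∈ Finset.range (⌊s⌋₊ + 1) then 1 / (mu 1 ρ + 1) else 0) +
        muTail 0 m ρ / (mu 1 ρ + 1) * p := by
    intro m
    obtain ⟨b0, b1⟩ := muTail_zero_bounds ρ hρ m
    have c0 : 0 ≤ muTail 0 m ρ / (mu 1 ρ + 1) := div_nonneg b0 hpos.le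
    have c1 : muTail 0 m ρ / (mu 1 ρ + 1) ≤ 1 / (mu 1 ρ + 1) :=
      div_le_div_of_nonneg_right b1 hpos.le
    split_ifs with hm
    · have q1 : (P x (NoReturnUpTo A (m : ℝ))).toReal ≤ 1 := measureReal_le_one
      have := mul_le_of_le_one_right c0 q1
      have := mul_nonneg c0 hp0
      linarith
    · rw [zero_add]
      refine mul_le_mul_of_nonneg_left ?_ c0
      refine ENNReal.toReal_mono (measure_ne_top _ _) (measure_mono ?_)
      intro ω hω t ht hts
      refine hω t ht ?_
      have h3 : ⌊s⌋₊ < m := by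
        simp only [Finset.mem_range] at hm
        omega
      have h4 : s < m := (Nat.floor_lt' (by omega)).mp h3
      linarith
  have hn : ∀ m : ℕ, 0 ≤ muTail 0 m ρ / (mu 1 ρ + 1) *
      (P x (NoReturnUpTo A (m : ℝ))).toReal := fun m =>
    mul_nonneg (div_nonneg (muTail_zero_bounds ρ hρ m).1 hpos.le) ENNReal.toReal_nonneg
  have h12 := h2.add h1
  have hs := Summable.of_nonneg_of_le hn hle h12.summable
  exact hasSum_le hle hs.hasSum h12

/-- Bound (2.19) on the `ρ`-capacity: for `d ≥ 3` and `ρ` with `3 ≤ μ₁(ρ) < ∞`,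
`cap^{(ρ)}(A) ≤ |A|(⌊μ₁ log^{-10}μ₁⌋+1)/(μ₁+1) + cap(A, μ₁(ρ))`; in particular
`cap^{(ρ)}(A) ≤ |A|(log^{-10}μ₁ + (μ₁+1)^{-1}) + cap(A, μ₁(ρ))`. -/
theorem capRho_le
    (d : ℕ) (hd : 3 ≤ d)
    (Pw : Zd d → Measure (ℕ → Zd d)) (hPw : IsSRWFamily d Pw)
    (ρ : ℕ → ℝ) (hρ : IsDist ρ) (hsum : Summable fun l : ℕ => (l : ℝ) * ρ l)
    (hmean : 3 ≤ mu 1 ρ) (A : Finset (Zd d)) :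
    capRho Pw ρ A ≤
        (A.card : ℝ) * ((⌊mu 1 ρ / (Real.log (mu 1 ρ)) ^ (10 : ℕ)⌋₊ : ℕ) + 1) / (mu 1 ρ + 1) +
          capTrunc Pw A (mu 1 ρ) ∧
      capRho Pw ρ A ≤
        (A.card : ℝ) * (1 / (Real.log (mu 1 ρ)) ^ (10 : ℕ) + 1 / (mu 1 ρ + 1)) +
          capTrunc Pw A (mu 1 ρ) := by
  have hpos : 0 < mu 1 ρ + 1 := by linarith
  have hlog : 0 < Real.log (mu 1 ρ) ^ (10 : ℕ) := pow_pos (Real.log_pos (by linarith)) _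
  have key : capRho Pw ρ A ≤
        (A.card : ℝ) * ((⌊mu 1 ρ / (Real.log (mu 1 ρ)) ^ (10 : ℕ)⌋₊ : ℕ) + 1) / (mu 1 ρ + 1) +
          capTrunc Pw A (mu 1 ρ) := by
    have h := Finset.sum_le_sum fun x (_ : x ∈ A) => equilRho_le Pw hPw ρ hρ hsum hmean (↑A) x
      (mu 1 ρ / (Real.log (mu 1 ρ)) ^ (10 : ℕ))
    rw [Finset.sum_add_distrib, Finset.sum_const, nsmul_eq_mul, ← mul_div_assoc] at h
    exact h
  refine ⟨key, key.trans ?_⟩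
  rw [mul_div_assoc]
  gcongr
  rw [add_div]
  refine add_le_add ?_ le_rfl
  have hfl : ((⌊mu 1 ρ / (Real.log (mu 1 ρ)) ^ (10 : ℕ)⌋₊ : ℕ) : ℝ) ≤
      mu 1 ρ / (Real.log (mu 1 ρ)) ^ (10 : ℕ) := Nat.floor_le (by positivity)
  rw [div_le_iff₀ hpos]
  refine hfl.trans ?_
  rw [div_mul_eq_mul_div, one_mul]
  gcongr
  linarith

end FRIPaper
end
end

section
/- Let d ≥ 4, u > 0, and let ρ be a probability distribution on ℕ with finite positive mean. There exists a coupling ℚ of the exploration sequence (𝓛_i)_{i≥1} and the dominating exploration sequence (𝓛'_i)_{i≥1} such that ℚ[𝓛_i ⊆ 𝓛'_i] = 1 for every i ≥ 1, where the containment is as multisets of trajectories. -/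
open MeasureTheory ProbabilityTheory Filter Topology
open scoped ENNReal NNReal Classical

noncomputable section

namespace FRIPaper

/-! ### Proof of the domination -/

/-- `η` belongs to the trajectories explored at step `n`. -/
def InLayer {d : ℕ} (ω : Config d) (n : ℕ) (η : Traj d) : Prop :=
  hits η (exploreSets ω n).1 ∧ ¬ hits η (exploreSets ω n).2

theorem fst_subset_snd {d : ℕ} (ω : Config d) {i m : ℕ} (h : i < m) :
    (exploreSets ω i).1 ⊆ (exploreSets ω m).2 := by
  induction m with
  | zero => omega
  | succ m ih =>
    intro y hy
    rcases Nat.lt_succ_iff_lt_or_eq.mp h with h | h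
    · exact Or.inr (ih h hy)
    · subst h; exact Or.inl hy

theorem InLayer.unique {d : ℕ} {ω : Config d} {i m : ℕ} {η : Traj d}
    (h1 : InLayer ω i η) (h2 : InLayer ω m η) : i = m := by
  by_contra hne
  rcases Nat.lt_or_gt_of_ne hne with h | h
  · obtain ⟨y, hy, hy'⟩ := h1.1
    exact h2.2 ⟨y, hy, fst_subset_snd ω h hy'⟩
  · obtain ⟨y, hy, hy'⟩ := h2.1
    exact h1.2 ⟨y, hy, fst_subset_snd ω h hy'⟩

theorem exploreSets_congr {d : ℕ} (ω ω' : Config d) (k : ℕ)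
    (h : ∀ i < k, ∀ η, InLayer ω i η → ω' η = ω η) :
    exploreSets ω' k = exploreSets ω k := by
  induction k with
  | zero => rfl
  | succ k ih =>
    have e := ih (fun i hi => h i (by omega))
    simp only [exploreSets, e]
    congr 1
    ext y
    simp only [Set.mem_setOf_eq]
    constructor
    · rintro ⟨η, h0, h1, h2, h3⟩
      exact ⟨η, by rwa [h k (by omega) η ⟨h1, h2⟩] at h0, h1, h2, h3⟩
    · rintro ⟨η, h0, h1, h2, h3⟩
      exact ⟨η, by rwa [h k (by omega) η ⟨h1, h2⟩], h1, h2, h3⟩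

/-- Swap the copies `0` and `n+1` of all trajectories in `B` explored at step `n`. -/
def stepS {d : ℕ} (B : Set (Traj d)) (n : ℕ) (j : ℕ → Config d) : ℕ → Config d :=
  fun i ζ => if ζ ∈ B ∧ InLayer (j 0) n ζ then j (Equiv.swap 0 (n + 1) i) ζ else j i ζ

theorem stepS_sets {d : ℕ} (B : Set (Traj d)) (n : ℕ) (j : ℕ → Config d) {k : ℕ} (hk : k ≤ n) :
    exploreSets (stepS B n j 0) k = exploreSets (j 0) k := by
  apply exploreSets_congr
  intro i hi η hη
  simp only [stepS]
  rw [if_neg]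
  rintro ⟨_, h⟩
  have := hη.unique h
  omega

theorem stepS_inLayer {d : ℕ} (B : Set (Traj d)) (n : ℕ) (j : ℕ → Config d) (η : Traj d) :
    InLayer (stepS B n j 0) n η ↔ InLayer (j 0) n η := by
  simp only [InLayer, stepS_sets B n j le_rfl]

theorem measurable_exploreSets {d : ℕ} (k : ℕ) :
    (∀ y : Zd d, MeasurableSet {ω : Config d | y ∈ (exploreSets ω k).1}) ∧
    (∀ y : Zd d, MeasurableSet {ω : Config d | y ∈ (exploreSets ω k).2}) := by
  induction k with
  | zero => exact ⟨fun y => MeasurableSet.const _, fun y => MeasurableSet.const _⟩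
  | succ k ih =>
    obtain ⟨h1, h2⟩ := ih
    refine ⟨fun y => ?_, fun y => (h1 y).union (h2 y)⟩
    have : {ω : Config d | y ∈ (exploreSets ω (k + 1)).1} =
      ⋃ η : Traj d, ({ω : Config d | 0 < ω η} ∩ ((⋃ z : Zd d, {ω | z ∈ η} ∩
        {ω : Config d | z ∈ (exploreSets ω k).1}) ∩ ((⋃ z : Zd d, {ω | z ∈ η} ∩
        {ω : Config d | z ∈ (exploreSets ω k).2})ᶜ ∩ {ω | y ∈ η}))) := by
      ext ω
      simp [exploreSets, hits]
    rw [this]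
    refine MeasurableSet.iUnion fun η => ?_
    refine MeasurableSet.inter ?_ (MeasurableSet.inter ?_ (MeasurableSet.inter ?_ ?_))
    · exact measurableSet_lt measurable_const (measurable_pi_apply η)
    · exact MeasurableSet.iUnion fun z => (MeasurableSet.const _).inter (h1 z)
    · exact (MeasurableSet.iUnion fun z => (MeasurableSet.const _).inter (h2 z)).compl
    · exact MeasurableSet.const _

theorem measurable_inLayer {d : ℕ} (n : ℕ) (η : Traj d) :
    MeasurableSet {ω : Config d | InLayer ω n η} := by
  obtain ⟨h1, h2⟩ := measurable_exploreSets (d := d) n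
  have : {ω : Config d | InLayer ω n η} = (⋃ z : Zd d, {ω | z ∈ η} ∩
        {ω : Config d | z ∈ (exploreSets ω n).1}) ∩ (⋃ z : Zd d, {ω | z ∈ η} ∩
        {ω : Config d | z ∈ (exploreSets ω n).2})ᶜ := by
    ext ω
    simp [InLayer, hits]
  rw [this]
  exact (MeasurableSet.iUnion fun z => (MeasurableSet.const _).inter (h1 z)).inter
    (MeasurableSet.iUnion fun z => (MeasurableSet.const _).inter (h2 z)).compl

theorem measurable_coord {d : ℕ} (i : ℕ) (ζ : Traj d) :
    Measurable fun j : ℕ → Config d => j i ζ :=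
  (measurable_pi_apply ζ).comp (measurable_pi_apply i)

theorem measurable_inLayer_zero {d : ℕ} (n : ℕ) (η : Traj d) :
    MeasurableSet {j : ℕ → Config d | InLayer (j 0) n η} := by
  have h0 : Measurable fun j : ℕ → Config d => j 0 := measurable_pi_apply 0
  exact h0 (measurable_inLayer n η)

theorem measurable_stepS {d : ℕ} (B : Set (Traj d)) (n : ℕ) : Measurable (stepS B n) := by
  refine measurable_pi_lambda _ fun i => measurable_pi_lambda _ fun ζ => ?_
  refine Measurable.ite ?_ (measurable_coord _ _) (measurable_coord _ _)
  exact (MeasurableSet.const (ζ ∈ B)).inter (measurable_inLayer_zero n ζ)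

/-- Finite-dimensional cylinders determine a probability measure. -/
theorem ext_of_cyl {Ω ι : Type*} [m : MeasurableSpace Ω] (X : ι → Ω → ℕ)
    (hX : ∀ i, Measurable (X i))
    (hgen : ∀ m' : MeasurableSpace Ω, (∀ i, Measurable[m'] (X i)) → m ≤ m')
    (μ ν : Measure Ω) [IsProbabilityMeasure μ] [IsProbabilityMeasure ν]
    (h : ∀ (F : Finset ι) (k : ι → ℕ),
      μ {ω | ∀ i ∈ F, X i ω = k i} = ν {ω | ∀ i ∈ F, X i ω = k i}) : μ = ν := by
  refine ext_of_generate_finite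
    {s | ∃ (F : Finset ι) (k : ι → ℕ), s = {ω | ∀ i ∈ F, X i ω = k i}} ?_ ?_ ?_ (by simp)
  · apply le_antisymm
    · apply hgen
      intro i
      refine @measurable_to_countable' _ _ _ _ (_) _ fun a => ?_
      apply MeasurableSpace.measurableSet_generateFrom
      exact ⟨{i}, fun _ => a, by ext ω; simp⟩
    · apply MeasurableSpace.generateFrom_le
      rintro s ⟨F, k, rfl⟩
      have : {ω | ∀ i ∈ F, X i ω = k i} = ⋂ i ∈ F, X i ⁻¹' {k i} := by ext ω; simp
      rw [this]
      exact Finset.measurableSet_biInter _ fun i _ => hX i (measurableSet_singleton _)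
  · rintro s ⟨F, k, rfl⟩ t ⟨G, l, rfl⟩ ⟨ω₀, h1, h2⟩
    refine ⟨F ∪ G, fun i => X i ω₀, ?_⟩
    ext ω
    simp only [Set.mem_inter_iff, Set.mem_setOf_eq, Finset.mem_union] at *
    constructor
    · rintro ⟨a, b⟩ i (hi | hi)
      · rw [a i hi, h1 i hi]
      · rw [b i hi, h2 i hi]
    · intro a
      exact ⟨fun i hi => by rw [a i (Or.inl hi), h1 i hi],
        fun i hi => by rw [a i (Or.inr hi), h2 i hi]⟩
  · rintro s ⟨F, k, rfl⟩
    exact h F k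

theorem ext_config {d : ℕ} (μ ν : Measure (Config d)) [IsProbabilityMeasure μ]
    [IsProbabilityMeasure ν]
    (h : ∀ (F : Finset (Traj d)) (k : Traj d → ℕ),
      μ {ω | ∀ η ∈ F, ω η = k η} = ν {ω | ∀ η ∈ F, ω η = k η}) : μ = ν := by
  refine ext_of_cyl (fun η ω => ω η) (fun η => measurable_pi_apply η) ?_ μ ν h
  intro m' hm'
  have : @Measurable _ _ m' MeasurableSpace.pi (id : Config d → Config d) :=
    @measurable_pi_lambda _ _ _ m' _ _ hm'
  intro s hs
  exact this hs

theorem ext_seq {d : ℕ} (μ ν : Measure (ℕ → Config d)) [IsProbabilityMeasure μ]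
    [IsProbabilityMeasure ν]
    (h : ∀ (F : Finset (ℕ × Traj d)) (k : ℕ × Traj d → ℕ),
      μ {j | ∀ p ∈ F, j p.1 p.2 = k p} = ν {j | ∀ p ∈ F, j p.1 p.2 = k p}) : μ = ν := by
  refine ext_of_cyl (fun (p : ℕ × Traj d) (j : ℕ → Config d) => j p.1 p.2)
    (fun p => measurable_coord _ _) ?_ μ ν h
  intro m' hm'
  have : @Measurable _ _ m' MeasurableSpace.pi (id : (ℕ → Config d) → (ℕ → Config d)) :=
    @measurable_pi_lambda _ _ _ m' _ _ fun i =>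
      @measurable_pi_lambda _ _ _ m' _ _ fun ζ => hm' (i, ζ)
  intro s hs
  exact this hs

/-- Unconditional swap of copies `0` and `n+1` of the trajectory `η`. -/
def swapT {d : ℕ} (n : ℕ) (η : Traj d) (j : ℕ → Config d) : ℕ → Config d :=
  fun i ζ => if ζ = η then j (Equiv.swap 0 (n + 1) i) ζ else j i ζ

/-- The index map of `swapT`. -/
def swapIdx {d : ℕ} (n : ℕ) (η : Traj d) (p : ℕ × Traj d) : ℕ × Traj d :=
  if p.2 = η then (Equiv.swap 0 (n + 1) p.1, p.2) else p

theorem swapIdx_snd {d : ℕ} (n : ℕ) (η : Traj d) (p : ℕ × Traj d) :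
    (swapIdx n η p).2 = p.2 := by
  unfold swapIdx; split_ifs <;> rfl

theorem swapIdx_invol {d : ℕ} (n : ℕ) (η : Traj d) :
    Function.Involutive (swapIdx (d := d) n η) := by
  rintro ⟨i, ζ⟩
  by_cases h : ζ = η <;> simp [swapIdx, h]

theorem swapT_eq {d : ℕ} (n : ℕ) (η : Traj d) (j : ℕ → Config d) (p : ℕ × Traj d) :
    swapT n η j p.1 p.2 = j (swapIdx n η p).1 (swapIdx n η p).2 := by
  unfold swapIdx swapT; split_ifs <;> rfl

theorem swapT_invol {d : ℕ} (n : ℕ) (η : Traj d) :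
    Function.Involutive (swapT (d := d) n η) := by
  intro j
  funext i ζ
  by_cases h : ζ = η <;> simp [swapT, h]

theorem measurable_swapT {d : ℕ} (n : ℕ) (η : Traj d) : Measurable (swapT n η) := by
  refine measurable_pi_lambda _ fun i => measurable_pi_lambda _ fun ζ => ?_
  exact Measurable.ite (MeasurableSet.const _) (measurable_coord _ _) (measurable_coord _ _)

theorem swapT_preserving {d : ℕ} {u : ℝ} {ρ : ℕ → ℝ} {J : Measure (ℕ → Config d)}
    (hJ : IsFRIseq d u ρ J) (n : ℕ) (η : Traj d) : MeasurePreserving (swapT n η) J J := by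
  have hm := measurable_swapT (d := d) n η
  haveI := hJ.1
  haveI : IsProbabilityMeasure (J.map (swapT n η)) :=
    Measure.isProbabilityMeasure_map hm.aemeasurable
  refine ⟨hm, ext_seq _ _ fun F k => ?_⟩
  have hms : MeasurableSet {j : ℕ → Config d | ∀ p ∈ F, j p.1 p.2 = k p} := by
    have : {j : ℕ → Config d | ∀ p ∈ F, j p.1 p.2 = k p}
        = ⋂ p ∈ F, (fun j : ℕ → Config d => j p.1 p.2) ⁻¹' {k p} := by ext ω; simp
    rw [this]
    exact Finset.measurableSet_biInter _ fun i _ =>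
      measurable_coord _ _ (measurableSet_singleton _)
  rw [Measure.map_apply hm hms, hJ.2 F k]
  have e : swapT n η ⁻¹' {j : ℕ → Config d | ∀ p ∈ F, j p.1 p.2 = k p} =
      {j | ∀ p ∈ F.image (swapIdx n η), j p.1 p.2 = k (swapIdx n η p)} := by
    ext j
    simp only [Set.mem_preimage, Set.mem_setOf_eq, Finset.forall_mem_image, swapT_eq,
      swapIdx_invol n η _]
  rw [e, hJ.2, Finset.prod_image (fun a _ b _ hab => (swapIdx_invol n η).injective hab)]
  refine Finset.prod_congr rfl fun p _ => ?_
  rw [swapIdx_snd, swapIdx_invol n η p]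

theorem stepS_singleton {d : ℕ} (n : ℕ) (η : Traj d) (j : ℕ → Config d) :
    stepS {η} n j = if InLayer (j 0) n η then swapT n η j else j := by
  funext i ζ
  by_cases h : InLayer (j 0) n η
  · by_cases h' : ζ = η
    · subst h'; simp [stepS, swapT, h]
    · simp [stepS, swapT, h, h']
  · by_cases h' : ζ = η
    · subst h'; simp [stepS, h]
    · simp [stepS, h, h']

theorem swapT_inLayer {d : ℕ} (n : ℕ) (η : Traj d) (j : ℕ → Config d) :
    InLayer (swapT n η j 0) n η ↔ InLayer (j 0) n η := by
  have key : ∀ j : ℕ → Config d, InLayer (j 0) n η → InLayer (swapT n η j 0) n η := by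
    intro j h
    have := (stepS_inLayer {η} n j η).mpr h
    rwa [stepS_singleton, if_pos h] at this
  refine ⟨fun h => ?_, key j⟩
  have := key _ h
  rwa [swapT_invol n η j] at this

theorem stepS_singleton_preserving {d : ℕ} {u : ℝ} {ρ : ℕ → ℝ} {J : Measure (ℕ → Config d)}
    (hJ : IsFRIseq d u ρ J) (n : ℕ) (η : Traj d) : MeasurePreserving (stepS {η} n) J J := by
  refine ⟨measurable_stepS _ _, ?_⟩
  have hC : MeasurableSet {j : ℕ → Config d | InLayer (j 0) n η} :=
    measurable_inLayer_zero n η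
  ext A hA
  rw [Measure.map_apply (measurable_stepS _ _) hA,
    ← measure_inter_add_diff (stepS {η} n ⁻¹' A) hC, ← measure_inter_add_diff A hC]
  have e1 : stepS {η} n ⁻¹' A ∩ {j : ℕ → Config d | InLayer (j 0) n η} =
      swapT n η ⁻¹' (A ∩ {j : ℕ → Config d | InLayer (j 0) n η}) := by
    ext j
    simp only [Set.mem_inter_iff, Set.mem_preimage, Set.mem_setOf_eq, swapT_inLayer,
      stepS_singleton]
    by_cases h : InLayer (j 0) n η <;> simp [h]
  have e2 : stepS {η} n ⁻¹' A \ {j : ℕ → Config d | InLayer (j 0) n η} =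
      A \ {j : ℕ → Config d | InLayer (j 0) n η} := by
    ext j
    simp only [Set.mem_diff, Set.mem_preimage, Set.mem_setOf_eq, stepS_singleton]
    by_cases h : InLayer (j 0) n η <;> simp [h]
  rw [e1, e2, (swapT_preserving hJ n η).measure_preimage (hA.inter hC).nullMeasurableSet]

theorem stepS_finset_preserving {d : ℕ} {u : ℝ} {ρ : ℕ → ℝ} {J : Measure (ℕ → Config d)}
    (hJ : IsFRIseq d u ρ J) (n : ℕ) (F : Finset (Traj d)) :
    MeasurePreserving (stepS (↑F : Set (Traj d)) n) J J := by
  induction F using Finset.induction_on with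
  | empty =>
    have : stepS (↑(∅ : Finset (Traj d)) : Set (Traj d)) n = id := by
      funext j i ζ
      simp [stepS]
    rw [this]
    exact MeasurePreserving.id J
  | insert η F hη ih =>
    have : stepS (↑(insert η F) : Set (Traj d)) n
        = stepS {η} n ∘ stepS (↑F : Set (Traj d)) n := by
      funext j i ζ
      rw [Function.comp_apply]
      conv_rhs => rw [stepS]
      rw [stepS_inLayer]
      by_cases h' : ζ = η
      · subst h'; simp [stepS, hη]
      · simp [stepS, h']
    rw [this]
    exact (stepS_singleton_preserving hJ n η).comp ih

theorem stepS_univ_preserving {d : ℕ} {u : ℝ} {ρ : ℕ → ℝ} {J : Measure (ℕ → Config d)}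
    (hJ : IsFRIseq d u ρ J) (n : ℕ) : MeasurePreserving (stepS Set.univ n) J J := by
  have hm := measurable_stepS (d := d) Set.univ n
  haveI := hJ.1
  haveI : IsProbabilityMeasure (J.map (stepS Set.univ n)) :=
    Measure.isProbabilityMeasure_map hm.aemeasurable
  refine ⟨hm, ext_seq _ _ fun F k => ?_⟩
  have hms : MeasurableSet {j : ℕ → Config d | ∀ p ∈ F, j p.1 p.2 = k p} := by
    have : {j : ℕ → Config d | ∀ p ∈ F, j p.1 p.2 = k p}
        = ⋂ p ∈ F, (fun j : ℕ → Config d => j p.1 p.2) ⁻¹' {k p} := by ext ω; simp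
    rw [this]
    exact Finset.measurableSet_biInter _ fun i _ =>
      measurable_coord _ _ (measurableSet_singleton _)
  rw [Measure.map_apply hm hms,
    ← (stepS_finset_preserving hJ n (F.image Prod.snd)).measure_preimage hms.nullMeasurableSet]
  congr 1
  ext j
  simp only [Set.mem_preimage, Set.mem_setOf_eq]
  refine forall₂_congr fun p hp => ?_
  have : p.2 ∈ F.image Prod.snd := Finset.mem_image_of_mem _ hp
  simp only [stepS, Set.mem_univ, Finset.mem_coe, this]

/-- Iterated swaps. -/
def iter {d : ℕ} (j : ℕ → Config d) : ℕ → (ℕ → Config d)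
  | 0 => j
  | n + 1 => stepS Set.univ n (iter j n)

theorem iter_preserving {d : ℕ} {u : ℝ} {ρ : ℕ → ℝ} {J : Measure (ℕ → Config d)}
    (hJ : IsFRIseq d u ρ J) (n : ℕ) : MeasurePreserving (fun j => iter j n) J J := by
  induction n with
  | zero => exact MeasurePreserving.id J
  | succ n ih => exact (stepS_univ_preserving hJ n).comp ih

theorem iter_late {d : ℕ} (j : ℕ → Config d) (n i : ℕ) (hi : n < i) : iter j n i = j i := by
  induction n with
  | zero => rfl
  | succ n ih =>
    funext ζ
    rw [← ih (by omega)]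
    simp only [iter, stepS]
    rw [Equiv.swap_apply_of_ne_of_ne (by omega) (by omega), ite_self]

theorem iter_sets {d : ℕ} (j : ℕ → Config d) (k n : ℕ) (h : k ≤ n) :
    exploreSets (iter j n 0) k = exploreSets (iter j k 0) k := by
  induction n, h using Nat.le_induction with
  | base => rfl
  | succ n hn ih => rw [iter, stepS_sets _ _ _ hn, ih]

/-- Trajectories explored at step `k`. -/
def Dset {d : ℕ} (j : ℕ → Config d) (k : ℕ) (η : Traj d) : Prop := InLayer (iter j k 0) k η

theorem Dset_iff {d : ℕ} (j : ℕ → Config d) (k n : ℕ) (h : k ≤ n) (η : Traj d) :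
    InLayer (iter j n 0) k η ↔ Dset j k η := by
  simp only [Dset, InLayer, iter_sets j k n h]

theorem Dset_unique {d : ℕ} {j : ℕ → Config d} {k n : ℕ} {η : Traj d}
    (h1 : Dset j k η) (h2 : Dset j n η) : k = n :=
  ((Dset_iff j k (max k n) (le_max_left _ _) η).mpr h1).unique
    ((Dset_iff j n (max k n) (le_max_right _ _) η).mpr h2)

theorem iter_of_Dset {d : ℕ} (j : ℕ → Config d) (k n : ℕ) (h : k < n) (η : Traj d)
    (hη : Dset j k η) : iter j n 0 η = j (k + 1) η := by
  induction n, h using Nat.le_induction with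
  | base =>
    have hη' := hη
    rw [Dset] at hη'
    simp only [iter, stepS, Nat.succ_eq_add_one, Set.mem_univ, true_and, if_pos hη',
      Equiv.swap_apply_left]
    rw [iter_late j k (k + 1) (by omega)]
  | succ n hn ih =>
    rw [iter, stepS, if_neg, ih]
    rintro ⟨_, h2⟩
    have : k = n := Dset_unique hη h2
    omega

theorem iter_of_not_Dset {d : ℕ} (j : ℕ → Config d) (n : ℕ) (η : Traj d)
    (hη : ∀ k, ¬ Dset j k η) : iter j n 0 η = j 0 η := by
  induction n with
  | zero => rfl
  | succ n ih =>
    rw [iter, stepS, if_neg, ih]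
    rintro ⟨_, h2⟩
    exact hη n h2

/-- The limiting configuration. -/
def limCfg {d : ℕ} (j : ℕ → Config d) : Config d := fun η =>
  if h : ∃ k, Dset j k η then j (Nat.find h + 1) η else j 0 η

theorem limCfg_of_Dset {d : ℕ} (j : ℕ → Config d) (k : ℕ) (η : Traj d)
    (hη : Dset j k η) : limCfg j η = j (k + 1) η := by
  have h : ∃ k, Dset j k η := ⟨k, hη⟩
  rw [limCfg, dif_pos h, Dset_unique (Nat.find_spec h) hη]

theorem limCfg_eventually {d : ℕ} (j : ℕ → Config d) (η : Traj d) :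
    ∀ᶠ n in atTop, iter j n 0 η = limCfg j η := by
  by_cases h : ∃ k, Dset j k η
  · obtain ⟨k, hk⟩ := h
    filter_upwards [eventually_gt_atTop k] with n hn
    rw [limCfg_of_Dset j k η hk, iter_of_Dset j k n hn η hk]
  · refine Eventually.of_forall fun n => ?_
    rw [iter_of_not_Dset j n η (by simpa using h), limCfg, dif_neg h]

theorem limCfg_sets {d : ℕ} (j : ℕ → Config d) (k : ℕ) :
    exploreSets (limCfg j) k = exploreSets (iter j k 0) k := by
  apply exploreSets_congr
  intro i hi η hη
  have h := (Dset_iff j i k hi.le η).mp hη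
  rw [limCfg_of_Dset j i η h, iter_of_Dset j i k hi η h]

theorem limCfg_inLayer {d : ℕ} (j : ℕ → Config d) (k : ℕ) (η : Traj d) :
    InLayer (limCfg j) k η ↔ Dset j k η := by
  simp only [Dset, InLayer, limCfg_sets j k]

theorem measurable_limCfg {d : ℕ} {u : ℝ} {ρ : ℕ → ℝ} {J : Measure (ℕ → Config d)}
    (hJ : IsFRIseq d u ρ J) : Measurable (limCfg (d := d)) := by
  refine measurable_pi_lambda _ fun η => ?_
  refine measurable_of_tendsto_metrizable (f := fun n (j : ℕ → Config d) => iter j n 0 η)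
    (fun n => (measurable_coord 0 η).comp (iter_preserving hJ n).measurable) ?_
  rw [tendsto_pi_nhds]
  intro j
  exact tendsto_const_nhds.congr' ((limCfg_eventually j η).mono fun n hn => hn.symm)

theorem limCfg_subset {d : ℕ} (j : ℕ → Config d) (k : ℕ) :
    (exploreSets (limCfg j) k).1 ⊆ exploreSets' j k := by
  induction k with
  | zero => exact subset_rfl
  | succ k ih =>
    rintro y ⟨η, h0, h1, h2, h3⟩
    rw [limCfg_of_Dset j k η ((limCfg_inLayer j k η).mp ⟨h1, h2⟩)] at h0
    obtain ⟨z, hz, hz'⟩ := h1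
    exact ⟨η, h0, ⟨z, hz, ih hz'⟩, h3⟩

theorem limCfg_layer_le {d : ℕ} (j : ℕ → Config d) (i : ℕ) (η : Traj d) :
    exploreLayer (limCfg j) i η ≤ exploreLayer' j i η := by
  cases i with
  | zero => exact le_rfl
  | succ k =>
    simp only [exploreLayer, exploreLayer']
    by_cases h : hits η (exploreSets (limCfg j) k).1 ∧ ¬ hits η (exploreSets (limCfg j) k).2
    · rw [if_pos h, limCfg_of_Dset j k η ((limCfg_inLayer j k η).mp h), if_pos]
      obtain ⟨z, hz, hz'⟩ := h.1
      exact ⟨z, hz, limCfg_subset j k hz'⟩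
    · rw [if_neg h]
      exact Nat.zero_le _

theorem map_limCfg {d : ℕ} {u : ℝ} {ρ : ℕ → ℝ} {P : Measure (Config d)}
    {J : Measure (ℕ → Config d)} (hP : IsFRI d u ρ P)
    (hJ : IsFRIseq d u ρ J) : J.map limCfg = P := by
  have hm := measurable_limCfg hJ
  haveI := hJ.1
  haveI := hP.1
  haveI : IsProbabilityMeasure (J.map limCfg) :=
    Measure.isProbabilityMeasure_map hm.aemeasurable
  refine ext_config _ _ fun F k => ?_
  have hms : MeasurableSet {ω : Config d | ∀ η ∈ F, ω η = k η} := by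
    have : {ω : Config d | ∀ η ∈ F, ω η = k η}
        = ⋂ η ∈ F, (fun ω : Config d => ω η) ⁻¹' {k η} := by ext ω; simp
    rw [this]
    exact Finset.measurableSet_biInter _ fun i _ =>
      measurable_pi_apply _ (measurableSet_singleton _)
  have hm0 : Measurable fun j : ℕ → Config d => j 0 := measurable_pi_apply 0
  rw [Measure.map_apply hm hms, hP.2 F k]
  have hn : ∀ n, J ((fun j => iter j n 0) ⁻¹' {ω : Config d | ∀ η ∈ F, ω η = k η}) =
      ∏ η ∈ F, poissonProb (friIntensity d u ρ η) (k η) := by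
    intro n
    have h1 := (iter_preserving hJ n).measure_preimage (hm0 hms).nullMeasurableSet
    have h2 := hJ.2 (F.image fun η => (0, η)) (fun p => k p.2)
    rw [Finset.prod_image (fun a _ b _ hab => (Prod.mk.inj hab).2)] at h2
    rw [← h2]
    refine Eq.trans h1 ?_
    congr 1
    ext j
    simp only [Set.mem_preimage, Set.mem_setOf_eq, Finset.forall_mem_image]
  have hlim := tendsto_measure_of_tendsto_indicator_of_isFiniteMeasure (μ := J) atTop
    (As := fun n => (fun j => iter j n 0) ⁻¹' {ω : Config d | ∀ η ∈ F, ω η = k η})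
    (A := limCfg ⁻¹' {ω : Config d | ∀ η ∈ F, ω η = k η})
    (fun n => (hm0.comp (iter_preserving hJ n).measurable) hms)
    (by
      intro j
      have : ∀ᶠ n in atTop, ∀ η ∈ F, iter j n 0 η = limCfg j η :=
        (Finset.eventually_all F).mpr fun η _ => limCfg_eventually j η
      filter_upwards [this] with n hn
      simp only [Set.mem_preimage, Set.mem_setOf_eq]
      exact forall₂_congr fun η hη => by rw [hn η hη])
  simp only [hn] at hlim
  exact (tendsto_nhds_unique hlim tendsto_const_nhds)

/-- **Lemma 3.1.** There is a coupling of the exploration sequence `(𝓛_i)`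
(a function of `𝒳^{u,ρ}`) and the dominating exploration `(𝓛'_i)` (a function of the
i.i.d. sequence `(𝒥_i)`) such that a.s. `𝓛_i ⊆ 𝓛'_i` as multisets, for every `i ≥ 1`. -/
theorem exploration_domination
    (d : ℕ) (hd : 4 ≤ d) (u : ℝ) (hu : 0 < u)
    (ρ : ℕ → ℝ) (hρ : IsDist ρ) (hmean : 0 < mu 1 ρ)
    (hsum : Summable fun l : ℕ => (l : ℝ) * ρ l)
    (P : Measure (Config d)) (hP : IsFRI d u ρ P)
    (J : Measure (ℕ → Config d)) (hJ : IsFRIseq d u ρ J) :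
    ∃ Q : Measure (Config d × (ℕ → Config d)),
      Q.map Prod.fst = P ∧ Q.map Prod.snd = J ∧
      ∀ i : ℕ, 1 ≤ i →
        Q {p | ∀ η : Traj d, exploreLayer p.1 i η ≤ exploreLayer' p.2 i η} = 1 := by
  haveI := hJ.1
  have hm := measurable_limCfg hJ
  have hg : Measurable fun j : ℕ → Config d => (limCfg j, j) := hm.prodMk measurable_id
  haveI : IsProbabilityMeasure (J.map fun j => (limCfg j, j)) :=
    Measure.isProbabilityMeasure_map hg.aemeasurable
  refine ⟨J.map fun j => (limCfg j, j), ?_, ?_, ?_⟩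
  · rw [Measure.map_map measurable_fst hg]
    exact map_limCfg hP hJ
  · rw [Measure.map_map measurable_snd hg]
    exact Measure.map_id
  · intro i _
    refine le_antisymm prob_le_one ?_
    refine le_trans ?_ (Measure.le_map_apply hg.aemeasurable _)
    have : (fun j : ℕ → Config d => (limCfg j, j)) ⁻¹'
        {p | ∀ η : Traj d, exploreLayer p.1 i η ≤ exploreLayer' p.2 i η} = Set.univ := by
      ext j
      simp only [Set.mem_preimage, Set.mem_setOf_eq, Set.mem_univ, iff_true]
      exact limCfg_layer_le j i
    rw [this, measure_univ]

end FRIPaper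
end
end

section
/- Let d ≥ 4, u > 0, and let ρ be a probability distribution on ℕ with 0 < μ_1(ρ) and μ_2(ρ) < ∞. For every finite A ⊆ ℤ^d, the expected total length of the trajectories of 𝒳^{u,ρ} whose range intersects A satisfies 𝔼[ Σ_{η ∈ 𝒳^{u,ρ}[A]} T(η) ] ≤ u·(μ_2(ρ)/μ_1(ρ))·κ^{(ρ)}(A), where T(η) denotes the length (number of steps) of the trajectory η and 𝒳^{u,ρ}[A] is the multiset of trajectories of 𝒳^{u,ρ} intersecting A. -/
open MeasureTheory ProbabilityTheory Filter Topology
open scoped ENNReal NNReal Classical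

noncomputable section

namespace FRIPaper

/-! ### Proof -/

lemma poisson_mean (r : ℝ) (hr : 0 ≤ r) :
    ∑' k : ℕ, (k : ℝ≥0∞) * poissonProb r k = ENNReal.ofReal r := by
  rw [tsum_eq_zero_add' ENNReal.summable]
  have h : ∀ k : ℕ, ((k + 1 : ℕ) : ℝ≥0∞) * poissonProb r (k + 1)
      = ENNReal.ofReal (r * Real.exp (-r) * (r ^ k / k.factorial)) := by
    intro k
    unfold poissonProb
    rw [← ENNReal.ofReal_natCast, ← ENNReal.ofReal_mul (by positivity)]
    congr 1
    rw [Nat.factorial_succ]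
    push_cast
    have : (k.factorial : ℝ) ≠ 0 := by positivity
    field_simp
    ring
  simp only [h]
  have hs : HasSum (fun k : ℕ => r ^ k / (k.factorial : ℝ)) (Real.exp r) := by
    rw [Real.exp_eq_exp_ℝ]
    exact NormedSpace.expSeries_div_hasSum_exp r
  have hs2 := hs.mul_left (r * Real.exp (-r))
  rw [← ENNReal.ofReal_tsum_of_nonneg (fun k => by positivity) hs2.summable, hs2.tsum_eq,
    mul_assoc, ← Real.exp_add]
  simp

lemma fri_mean {d : ℕ} {ι : Traj d → ℝ} {P : Measure (Config d)} (hP : IsPoissonPP d ι P)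
    (η : Traj d) (h : 0 ≤ ι η) :
    ∫⁻ ω, ((ω η : ℕ) : ℝ≥0∞) ∂P = ENNReal.ofReal (ι η) := by
  have hm : Measurable (fun ω : Config d => ω η) := measurable_pi_apply η
  rw [← poisson_mean _ h,
    ← lintegral_map (f := fun k : ℕ => (k : ℝ≥0∞)) (measurable_of_countable _) hm,
    lintegral_countable']
  congr 1
  ext k
  rw [Measure.map_apply hm (measurableSet_singleton k)]
  congr 1
  have := hP.2 {η} (fun _ => k)
  have e : (fun ω : Config d => ω η) ⁻¹' {k} = {ω | ∀ η' ∈ ({η} : Finset (Traj d)), ω η' = k} := by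
    ext ω
    simp
  rw [e, this]
  simp

/-- cylinder of a list -/
def cyl {d : ℕ} (w : Traj d) : Set (ℕ → Zd d) := {ω | ∀ t < w.length, ω t = w.getD t 0}

lemma cyl_meas {d : ℕ} (w : Traj d) : MeasurableSet (cyl w) := by
  have : cyl w = ⋂ t ∈ Finset.range w.length, (fun ω : ℕ → Zd d => ω t) ⁻¹' {w.getD t 0} := by
    ext ω
    simp [cyl]
  rw [this]
  exact Finset.measurableSet_biInter _ fun t _ => measurable_pi_apply t (measurableSet_singleton _)

lemma cyl_prob {d : ℕ} {x : Zd d} {Q : Measure (ℕ → Zd d)} (hQ : IsSRW d x Q)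
    (w : Traj d) (T : ℕ) (hl : w.length = T + 1) (hc : w.Chain' IsNN) (hx : w[0]? = some x) :
    Q (cyl w) = (((2 * d : ℕ) : ℝ≥0∞))⁻¹ ^ T := by
  have h := hQ.2 T (fun t => w.getD t 0)
  rw [if_pos] at h
  · rw [← h]
    congr 1
    ext ω
    simp only [cyl, Set.mem_setOf_eq, hl, Nat.lt_succ_iff]
  · refine ⟨by simp [List.getD, hx], fun t ht => ?_⟩
    have := List.isChain_iff_getElem.1 hc t (by omega)
    rw [List.getD_eq_getElem _ _ (by omega), List.getD_eq_getElem _ _ (by omega)]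
    exact this

lemma cyl_sum {d : ℕ} {x : Zd d} {Q : Measure (ℕ → Zd d)} (hQ : IsSRW d x Q)
    (T : ℕ) (E : Traj d → Prop) (B : Set (ℕ → Zd d))
    (hB : ∀ w : Traj d, w.length = T + 1 → E w → cyl w ⊆ B) :
    ∑' w : Traj d, (if w.length = T + 1 ∧ w.Chain' IsNN ∧ w[0]? = some x ∧ E w then
      (((2 * d : ℕ) : ℝ≥0∞))⁻¹ ^ T else 0) ≤ Q B := by
  set S : Set (Traj d) := {w | w.length = T + 1 ∧ w.Chain' IsNN ∧ w[0]? = some x ∧ E w} with hS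
  have h1 : ∀ w : Traj d, (if w.length = T + 1 ∧ w.Chain' IsNN ∧ w[0]? = some x ∧ E w then
      (((2 * d : ℕ) : ℝ≥0∞))⁻¹ ^ T else 0) = S.indicator (fun w => Q (cyl w)) w := by
    intro w
    by_cases hw : w ∈ S
    · rw [Set.indicator_of_mem hw, cyl_prob hQ w T hw.1 hw.2.1 hw.2.2.1]
      exact if_pos hw
    · rw [Set.indicator_of_notMem hw]
      exact if_neg hw
  simp only [h1]
  rw [← tsum_subtype S (fun w => Q (cyl w)), ← measure_iUnion]
  · exact measure_mono (Set.iUnion_subset fun w => hB w.1 w.2.1 w.2.2.2.2)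
  · intro w v hwv
    refine Set.disjoint_left.2 fun ω hw hv => hwv ?_
    apply Subtype.ext
    have lw := w.2.1
    have lv := v.2.1
    refine List.ext_getElem (by omega) fun i h1 h2 => ?_
    have a := hw i h1
    have b := hv i h2
    rw [List.getD_eq_getElem _ _ h1] at a
    rw [List.getD_eq_getElem _ _ h2] at b
    rw [← a, ← b]
  · exact fun w => cyl_meas _

lemma split_sum {d : ℕ} {x : Zd d} {Q : Measure (ℕ → Zd d)} (hQ : IsSRW d x Q)
    (A : Set (Zd d)) (l m : ℕ) (hml : m ≤ l) :
    ∑' η : Traj d, (if η.length = l + 1 ∧ η.Chain' IsNN ∧ η[m]? = some x ∧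
        (∀ i < m, ∀ y, η[i]? = some y → y ∉ A) then
      (((2 * d : ℕ) : ℝ≥0∞))⁻¹ ^ l else 0) ≤ Q (NoReturnUpTo A (m : ℝ)) := by
  set q : ℝ≥0∞ := (((2 * d : ℕ) : ℝ≥0∞))⁻¹ with hq
  set E : Traj d → Prop := fun w => ∀ i, 0 < i → ∀ y, w[i]? = some y → y ∉ A with hE
  set F : Traj d → ℝ≥0∞ := fun w =>
    if w.length = m + 1 ∧ w.Chain' IsNN ∧ w[0]? = some x ∧ E w then q ^ m else 0 with hF
  set G : Traj d → ℝ≥0∞ := fun w =>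
    if w.length = (l - m) + 1 ∧ w.Chain' IsNN ∧ w[0]? = some x ∧ True then q ^ (l - m) else 0
    with hG
  have hFs : ∑' w, F w ≤ Q (NoReturnUpTo A (m : ℝ)) := by
    refine cyl_sum hQ m E _ ?_
    intro w hl hw ω hω t ht htm
    have htm' : t ≤ m := by exact_mod_cast htm
    have a := hω t (by omega)
    rw [List.getD_eq_getElem _ _ (by omega)] at a
    rw [a]
    exact hw t ht _ (List.getElem?_eq_getElem (by omega))
  have hGs : ∑' w, G w ≤ 1 := by
    refine (le_of_eq (tsum_congr fun w => ?_)).trans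
      ((cyl_sum hQ (l - m) (fun _ => True) Set.univ (fun _ _ _ => Set.subset_univ _)).trans ?_)
    · simp only [hG]
      congr
    · have := hQ.1
      simp
  let ψ : Traj d → Traj d × Traj d := fun η => ((η.take (m + 1)).reverse, η.drop m)
  have hψ : Function.Injective ψ := by
    intro a b hab
    simp only [ψ, Prod.mk.injEq, List.reverse_inj] at hab
    have h1 := congrArg (List.take m) hab.1
    simp only [List.take_take] at h1
    rw [min_eq_left (by omega)] at h1
    rw [← List.take_append_drop m a, ← List.take_append_drop m b, h1, hab.2]
  calc _ ≤ ∑' η : Traj d, (fun p : Traj d × Traj d => F p.1 * G p.2) (ψ η) := by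
        refine ENNReal.tsum_le_tsum fun η => ?_
        split_ifs with h
        · obtain ⟨h1, h2, h3, h4⟩ := h
          have e1 : F (ψ η).1 = q ^ m := by
            rw [hF]
            refine if_pos ⟨?_, ?_, ?_, ?_⟩
            · simp [ψ, h1]; omega
            · simp only [ψ]
              refine List.isChain_reverse.2 ?_
              refine List.IsChain.imp ?_ (h2.take _)
              intro a b hab
              unfold IsNN at *
              rw [← hab]
              refine Finset.sum_congr rfl fun i _ => ?_
              omega
            · simp only [ψ]
              rw [List.getElem?_reverse (by simp; omega)]
              simp only [List.length_take, h1]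
              rw [min_eq_left (by omega), List.getElem?_take]
              simpa using h3
            · intro i hi y hy
              simp only [ψ] at hy
              have hlen : i < m + 1 := by
                by_contra hcon
                rw [List.getElem?_eq_none (by simp; omega)] at hy
                simp at hy
              rw [List.getElem?_reverse (by simp; omega)] at hy
              simp only [List.length_take, h1] at hy
              rw [min_eq_left (by omega), List.getElem?_take, if_pos (by omega)] at hy
              exact h4 _ (by omega) y hy
          have e2 : G (ψ η).2 = q ^ (l - m) := by
            rw [hG]
            refine if_pos ⟨?_, ?_, ?_, trivial⟩
            · simp [ψ, h1]; omega
            · exact h2.drop _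
            · simpa [ψ] using h3
          simp only [e1, e2]
          rw [← pow_add, Nat.add_sub_cancel' hml]
        · exact zero_le
    _ ≤ ∑' p : Traj d × Traj d, F p.1 * G p.2 :=
        ENNReal.tsum_comp_le_tsum_of_injective hψ _
    _ = (∑' w, F w) * ∑' v, G v := by
        rw [ENNReal.tsum_prod (f := fun a b => F a * G b)]
        simp only [ENNReal.tsum_mul_left, ENNReal.tsum_mul_right]
    _ ≤ Q (NoReturnUpTo A (m : ℝ)) * 1 := mul_le_mul' hFs hGs
    _ = _ := mul_one _

lemma first_hit {d : ℕ} (A : Finset (Zd d)) (η : Traj d) (h : hits η (↑A)) :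
    ∃ x ∈ A, ∃ m, m < η.length ∧ η[m]? = some x ∧
      (∀ i < m, ∀ y, η[i]? = some y → y ∉ (↑A : Set (Zd d))) := by
  obtain ⟨y, hy, hyA⟩ := h
  obtain ⟨n, hn, rfl⟩ := List.getElem_of_mem hy
  have hex : ∃ m, ∃ x ∈ A, η[m]? = some x := ⟨n, _, hyA, List.getElem?_eq_getElem hn⟩
  obtain ⟨x, hx, hm⟩ := Nat.find_spec hex
  refine ⟨x, hx, Nat.find hex, (List.getElem?_eq_some_iff.1 hm).1, hm, ?_⟩
  intro i hi y hy hyA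
  exact Nat.find_min hex hi ⟨y, hyA, hy⟩

lemma intensity_sum {d : ℕ} (hd : 4 ≤ d) (u : ℝ) (hu : 0 < u)
    (ρ : ℕ → ℝ) (hρ : IsDist ρ) (hmean : 0 < mu 1 ρ)
    (Pw : Zd d → Measure (ℕ → Zd d)) (hPw : IsSRWFamily d Pw) (A : Finset (Zd d)) :
    ∑' η : Traj d, (if hits η (↑A) then ENNReal.ofReal (friIntensity d u ρ η) *
      (len η : ℝ≥0∞) else 0) ≤
    ∑ x ∈ A, ∑' m : ℕ, ∑' l : ℕ, (if m ≤ l then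
      ENNReal.ofReal (u / (mu 1 ρ + 1) * ((l : ℝ) ^ 1 * ρ l)) else 0) *
        Pw x (NoReturnUpTo (↑A) (m : ℝ)) := by
  set q : ℝ≥0∞ := (((2 * d : ℕ) : ℝ≥0∞))⁻¹ with hq
  set K : Zd d → ℕ → ℕ → Traj d → ℝ≥0∞ := fun x m l η =>
    (if η.length = l + 1 ∧ η.Chain' IsNN ∧ η[m]? = some x ∧
        (∀ i < m, ∀ y, η[i]? = some y → y ∉ (↑A : Set (Zd d))) then q ^ l else 0) with hK
  set c : ℕ → ℕ → ℝ≥0∞ := fun m l => (if m ≤ l then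
      ENNReal.ofReal (u / (mu 1 ρ + 1) * ((l : ℝ) ^ 1 * ρ l)) else 0) with hc
  have hqd : ENNReal.ofReal (1 / (2 * (d : ℝ))) = q := by
    rw [hq, one_div, ENNReal.ofReal_inv_of_pos (by positivity)]
    congr 1
    rw [← ENNReal.ofReal_natCast]
    push_cast
    rfl
  calc _ ≤ ∑' η : Traj d, ∑ x ∈ A, ∑' m : ℕ, ∑' l : ℕ, c m l * K x m l η := by
        refine ENNReal.tsum_le_tsum fun η => ?_
        split_ifs with h
        · by_cases hv : ValidTraj η
          · obtain ⟨x, hx, m, hm, hmx, hmin⟩ := first_hit A η h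
            have hlen : η.length = len η + 1 := by
              unfold len; omega
            refine le_trans ?_ (Finset.single_le_sum
              (f := fun x => ∑' m : ℕ, ∑' l : ℕ, c m l * K x m l η) (fun _ _ => zero_le) hx)
            refine le_trans ?_ (ENNReal.le_tsum m)
            refine le_trans ?_ (ENNReal.le_tsum (len η))
            have e1 : K x m (len η) η = q ^ (len η) := if_pos ⟨hlen, hv.2, hmx, hmin⟩
            have e2 : c m (len η) = _ := if_pos (by omega)
            have hr := hρ.1 (len η)
            rw [e1, e2, friIntensity, if_pos hv, ← hqd, ← ENNReal.ofReal_pow (by positivity),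
              ← ENNReal.ofReal_natCast (len η), ← ENNReal.ofReal_mul (by positivity),
              ← ENNReal.ofReal_mul (by positivity)]
            apply le_of_eq
            congr 1
            ring
          · simp [friIntensity, hv]
        · exact zero_le
    _ = ∑ x ∈ A, ∑' m : ℕ, ∑' l : ℕ, c m l * ∑' η : Traj d, K x m l η := by
        rw [Summable.tsum_finsetSum (fun _ _ => ENNReal.summable)]
        refine Finset.sum_congr rfl fun x _ => ?_
        rw [ENNReal.tsum_comm]
        refine tsum_congr fun m => ?_
        rw [ENNReal.tsum_comm]
        refine tsum_congr fun l => ?_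
        rw [ENNReal.tsum_mul_left]
    _ ≤ _ := by
        refine Finset.sum_le_sum fun x _ => ENNReal.tsum_le_tsum fun m =>
          ENNReal.tsum_le_tsum fun l => ?_
        by_cases hml : m ≤ l
        · refine mul_le_mul' le_rfl (le_of_eq_of_le (tsum_congr fun η => ?_)
            (split_sum (hPw x) _ l m hml))
          simp only [hK]
          congr
        · simp [hc, hml]

lemma nat_pow_le (l : ℕ) : (l : ℝ) ^ 1 ≤ (l : ℝ) ^ 2 := by
  have : l ^ 1 ≤ l ^ 2 := by nlinarith [Nat.le_self_pow (two_ne_zero) l]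
  exact_mod_cast this

lemma tail_summable (ρ : ℕ → ℝ) (hρ : IsDist ρ)
    (hsum2 : Summable fun l : ℕ => (l : ℝ) ^ 2 * ρ l) :
    (Summable fun l : ℕ => (l : ℝ) ^ 1 * ρ l) ∧
    (∀ m, Summable fun l : ℕ => if m ≤ l then (l : ℝ) ^ 1 * ρ l else 0) ∧
    (Summable fun m : ℕ => muTail 1 m ρ) := by
  have h1 : Summable fun l : ℕ => (l : ℝ) ^ 1 * ρ l := by
    refine Summable.of_nonneg_of_le (fun l => mul_nonneg (by positivity) (hρ.1 l))
      (fun l => ?_) hsum2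
    refine mul_le_mul_of_nonneg_right ?_ (hρ.1 l)
    exact nat_pow_le l
  have h2 : ∀ m, Summable fun l : ℕ => if m ≤ l then (l : ℝ) ^ 1 * ρ l else 0 := by
    intro m
    refine Summable.of_nonneg_of_le (fun l => ?_) (fun l => ?_) h1
    · have := mul_nonneg (pow_nonneg (Nat.cast_nonneg (α := ℝ) l) 1) (hρ.1 l)
      split_ifs <;> simp_all
    · have := mul_nonneg (pow_nonneg (Nat.cast_nonneg (α := ℝ) l) 1) (hρ.1 l)
      split_ifs <;> simp_all
  refine ⟨h1, h2, ?_⟩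
  have hn : ∀ l : ℕ, 0 ≤ (l : ℝ) ^ 1 * ρ l := fun l => mul_nonneg (by positivity) (hρ.1 l)
  have hn2 : ∀ m l : ℕ, 0 ≤ (if m ≤ l then (l : ℝ) ^ 1 * ρ l else 0) := by
    intro m l
    have := hn l
    split_ifs <;> simp_all
  have hin : ∀ l : ℕ, HasSum (fun m : ℕ => if m ≤ l then (l : ℝ) ^ 1 * ρ l else 0)
      ((l : ℝ) ^ 2 * ρ l + (l : ℝ) ^ 1 * ρ l) := by
    intro l
    have : ((l : ℝ) ^ 2 * ρ l + (l : ℝ) ^ 1 * ρ l) =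
        ∑ m ∈ Finset.range (l + 1), if m ≤ l then (l : ℝ) ^ 1 * ρ l else 0 := by
      rw [Finset.sum_congr rfl (g := fun _ => (l : ℝ) ^ 1 * ρ l)]
      · simp
        ring
      · intro m hm
        rw [if_pos (by simpa [Nat.lt_succ_iff] using hm)]
    rw [this]
    refine hasSum_sum_of_ne_finset_zero fun m hm => ?_
    rw [if_neg]
    simpa [Nat.lt_succ_iff] using hm
  have hp : Summable (fun p : ℕ × ℕ => if p.2 ≤ p.1 then (p.1 : ℝ) ^ 1 * ρ p.1 else 0) := by
    rw [summable_prod_of_nonneg (fun p => hn2 p.2 p.1)]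
    refine ⟨fun l => (hin l).summable, ?_⟩
    simp only [(hin _).tsum_eq]
    exact hsum2.add h1
  exact ((summable_prod_of_nonneg (fun p : ℕ × ℕ => hn2 p.1 p.2)).1 hp.prod_symm).2

/-- Expected total length of the trajectories of `𝒳^{u,ρ}` meeting a finite set `A`:
`𝔼[Σ_{η ∈ 𝒳^{u,ρ}[A]} T(η)] ≤ u·(μ₂(ρ)/μ₁(ρ))·κ^{(ρ)}(A)`. -/
theorem expected_total_length
    (d : ℕ) (hd : 4 ≤ d) (u : ℝ) (hu : 0 < u)
    (ρ : ℕ → ℝ) (hρ : IsDist ρ) (hmean : 0 < mu 1 ρ)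
    (hsum2 : Summable fun l : ℕ => (l : ℝ) ^ 2 * ρ l)
    (Pw : Zd d → Measure (ℕ → Zd d)) (hPw : IsSRWFamily d Pw)
    (A : Finset (Zd d))
    (P : Measure (Config d)) (hP : IsFRI d u ρ P) :
    (∫⁻ ω, ∑' η : Traj d,
        (if hits η (↑A) then (ω η : ℝ≥0∞) * (len η : ℝ≥0∞) else 0) ∂ P) ≤
      ENNReal.ofReal (u * (mu 2 ρ / mu 1 ρ) * kappa Pw ρ A) := by
  have hterm : ∀ l : ℕ, 0 ≤ (l : ℝ) ^ 1 * ρ l := fun l => mul_nonneg (by positivity) (hρ.1 l)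
  have hintens : ∀ η : Traj d, 0 ≤ friIntensity d u ρ η := by
    intro η
    unfold friIntensity
    have hr := hρ.1 (len η)
    split_ifs <;> positivity
  obtain ⟨hs1, hs2, hs3⟩ := tail_summable ρ hρ hsum2
  have htail : ∀ m, 0 ≤ muTail 1 m ρ := fun m => tsum_nonneg fun l => by
    have := hterm l
    split_ifs <;> simp_all
  have hmu2 : 0 < mu 2 ρ := by
    refine lt_of_lt_of_le hmean (hs1.tsum_le_tsum (fun l => ?_) hsum2)
    exact mul_le_mul_of_nonneg_right (nat_pow_le l) (hρ.1 l)
  have hprob : ∀ x m, (Pw x (NoReturnUpTo (↑A) (m : ℝ))) ≤ 1 := fun x m => by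
    have := (hPw x).1
    exact prob_le_one
  have hlhs : (∫⁻ ω, ∑' η : Traj d,
        (if hits η (↑A) then (ω η : ℝ≥0∞) * (len η : ℝ≥0∞) else 0) ∂ P) =
      ∑' η : Traj d, (if hits η (↑A) then ENNReal.ofReal (friIntensity d u ρ η) *
      (len η : ℝ≥0∞) else 0) := by
    have hme : ∀ η : Traj d, Measurable (fun ω : Config d => ((ω η : ℕ) : ℝ≥0∞)) := fun η =>
      (measurable_of_countable (fun k : ℕ => (k : ℝ≥0∞))).comp (measurable_pi_apply η)
    rw [lintegral_tsum]
    · refine tsum_congr fun η => ?_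
      split_ifs
      · rw [lintegral_mul_const _ (hme η), fri_mean hP η (hintens η)]
      · simp
    · intro η
      split_ifs
      · exact ((hme η).mul_const _).aemeasurable
      · exact aemeasurable_const
  rw [hlhs]
  refine (intensity_sum hd u hu ρ hρ hmean Pw hPw A).trans ?_
  have hsumm : ∀ x, Summable fun m : ℕ =>
      (muTail 1 m ρ / mu 2 ρ) * (Pw x (NoReturnUpTo (↑A) (m : ℝ))).toReal := by
    intro x
    refine Summable.of_nonneg_of_le (fun m => mul_nonneg (div_nonneg (htail m) hmu2.le)
      ENNReal.toReal_nonneg) (fun m => ?_) (hs3.div_const (mu 2 ρ))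
    exact mul_le_of_le_one_right (div_nonneg (htail m) hmu2.le)
      (ENNReal.toReal_mono ENNReal.one_ne_top (hprob x m))
  have hnn : ∀ x m, 0 ≤ (muTail 1 m ρ / mu 2 ρ) *
      (Pw x (NoReturnUpTo (↑A) ((m : ℕ) : ℝ))).toReal := fun x m =>
    mul_nonneg (div_nonneg (htail m) hmu2.le) ENNReal.toReal_nonneg
  unfold kappa
  rw [ENNReal.ofReal_mul (by positivity),
    ENNReal.ofReal_sum_of_nonneg (fun x _ => tsum_nonneg (hnn x)), Finset.mul_sum]
  refine Finset.sum_le_sum fun x _ => ?_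
  rw [ENNReal.ofReal_tsum_of_nonneg (hnn x) (hsumm x), ← ENNReal.tsum_mul_left]
  refine ENNReal.tsum_le_tsum fun m => ?_
  rw [ENNReal.tsum_mul_right, ENNReal.ofReal_mul (div_nonneg (htail m) hmu2.le),
    ENNReal.ofReal_toReal (ne_top_of_le_ne_top ENNReal.one_ne_top (hprob x m)), ← mul_assoc]
  refine mul_le_mul' ?_ le_rfl
  have hcs : ∑' l : ℕ, (if m ≤ l then
      ENNReal.ofReal (u / (mu 1 ρ + 1) * ((l : ℝ) ^ 1 * ρ l)) else 0) =
      ENNReal.ofReal (u / (mu 1 ρ + 1) * muTail 1 m ρ) := by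
    unfold muTail
    rw [← tsum_mul_left, ENNReal.ofReal_tsum_of_nonneg _ ((hs2 m).mul_left _)]
    · refine tsum_congr fun l => ?_
      split_ifs <;> simp
    · intro l
      have := hterm l
      refine mul_nonneg (by positivity) ?_
      split_ifs <;> simp_all
  rw [hcs, ← ENNReal.ofReal_mul (by positivity)]
  apply ENNReal.ofReal_le_ofReal
  have : u * (mu 2 ρ / mu 1 ρ) * (muTail 1 m ρ / mu 2 ρ) = u / mu 1 ρ * muTail 1 m ρ := by
    field_simp
  rw [this]
  refine mul_le_mul_of_nonneg_right ?_ (htail m)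
  gcongr
  linarith

end FRIPaper
end
end
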